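/- arXiv:1808.07190 — 3 statements merged into one kernel-verified Lean document; each statement's English description precedes it below -/
import Mathlib

section
/- Let N ≥ 2, r ≥ 2 and s ≥ 1 be integers with r ≤ N. Let h ∈ C_c^∞((0,1)) satisfy ∫_0^1 h(ρ) dρ = 0 and ∫_0^1 h(ρ)^r ρ^{−r+N+s−1} dρ ≠ 0, and define g : ℝ^N → ℝ by g(x) = ∫_0^{|x|} h(ρ) dρ (so g ∈ C_c^∞(B(0,1))). Then for every α ∈ I(r,N): ∫_{B(0,1)} M_α^α(D^2 g(x)) |x|^s dx ≠ 0, where M_α^α(D^2 g) denotes the determinant of the r×r submatrix of the Hessian matrix D^2 g obtained by selecting the rows and columns indexed by α. -/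
open MeasureTheory Filter Topology Real

noncomputable section

abbrev Euc (N : ℕ) := EuclideanSpace ℝ (Fin N)

/-- The (full signed) determinant of an `m`-dimensional matrix of order `N^m`:
`det A = ∑_{τ_2,…,τ_m ∈ S_N} (∏_{s=2}^m sgn τ_s) ∏_{k=1}^N a_{k τ_2(k) ⋯ τ_m(k)}`. -/
def hyperDet {N : ℕ} : {m : ℕ} → ((Fin m → Fin N) → ℝ) → ℝ
  | 0, A => A finZeroElim
  | m + 1, A =>
      ∑ τ : Fin m → Equiv.Perm (Fin N),
        (∏ s, ((Equiv.Perm.sign (τ s) : ℤ) : ℝ)) *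
          ∏ k : Fin N, A (Fin.cons k fun s => τ s k)

/-- classical partial derivative `∂_i f`. -/
def pderiv' {N : ℕ} (i : Fin N) (f : Euc N → ℝ) : Euc N → ℝ :=
  fun x => fderiv ℝ f x (EuclideanSpace.single i 1)

/-- iterated partial derivative `∂_{l_1} ∂_{l_2} ⋯ f`. -/
def pderivList {N : ℕ} : List (Fin N) → (Euc N → ℝ) → Euc N → ℝ
  | [], f => f
  | i :: l, f => pderiv' i (pderivList l f)

/-- the `m`th-Jacobian `(β,α)`-minor `M^β_α(D^m u)` of `u : Ω → ℝ^n`, i.e. the hyper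
determinant of the `(m+1)`-dimensional matrix of order `r^{m+1}` with entries
`∂_{α^1_{l_1}} ⋯ ∂_{α^m_{l_m}} u^{β_{l_0}}`. -/
def jacMinor {N n : ℕ} (m r : ℕ) (β : Fin r → Fin n) (α : Fin m → Fin r → Fin N)
    (u : Euc N → Fin n → ℝ) (x : Euc N) : ℝ :=
  hyperDet (m := m + 1) fun l : Fin (m + 1) → Fin r =>
    pderivList (List.ofFn fun s : Fin m => α s (l s.succ)) (fun y => u y (β (l 0))) x

/-- the `m`th-Jacobian `α`-minor `M_α(D^m v)` of a scalar function `v`. -/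
def scalMinor {N : ℕ} (m r : ℕ) (α : Fin m → Fin r → Fin N)
    (v : Euc N → ℝ) (x : Euc N) : ℝ :=
  hyperDet (m := m) fun l : Fin m → Fin r =>
    pderivList (List.ofFn fun s : Fin m => α s (l s)) v x

/-- the integer Sobolev norm `‖u‖_{W^{k,p}(Ω)} = ∑_{j ≤ k} ‖D^j u‖_{L^p(Ω)}`. -/
def intSobNorm {N : ℕ} {F : Type*} [NormedAddCommGroup F] [NormedSpace ℝ F]
    (Ω : Set (Euc N)) (k : ℕ) (p : ℝ) (u : Euc N → F) : ℝ :=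
  ∑ j ∈ Finset.range (k + 1), (∫ x in Ω, ‖iteratedFDeriv ℝ j u x‖ ^ p) ^ (1 / p)

open Classical in
/-- the (possibly fractional) Sobolev norm `‖u‖_{W^{s,p}(Ω)}`: for integer `s` the usual
Sobolev norm, for non-integer `s` the `W^{[s],p}` norm plus the Gagliardo seminorm of
`D^{[s]} u` with fractional exponent `s - [s]`. -/
def sobNorm {N : ℕ} {F : Type*} [NormedAddCommGroup F] [NormedSpace ℝ F]
    (Ω : Set (Euc N)) (s p : ℝ) (u : Euc N → F) : ℝ :=
  if ∃ k : ℕ, s = k then intSobNorm Ω ⌊s⌋₊ p u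
  else
    intSobNorm Ω ⌊s⌋₊ p u +
      (∫ x in Ω, ∫ y in Ω,
          ‖iteratedFDeriv ℝ ⌊s⌋₊ u x - iteratedFDeriv ℝ ⌊s⌋₊ u y‖ ^ p /
            ‖x - y‖ ^ ((N : ℝ) + (s - ⌊s⌋₊) * p)) ^ (1 / p)

/-- `‖D^m ψ‖_{L^∞}`, the sup of the `m`-th derivatives of `ψ`. -/
def supDm {N : ℕ} (m : ℕ) (ψ : Euc N → ℝ) : ℝ := ⨆ x, ‖iteratedFDeriv ℝ m ψ x‖

/-- `ψ ∈ C_c^∞(Ω)`. -/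
def IsCinfc {N : ℕ} (Ω : Set (Euc N)) (ψ : Euc N → ℝ) : Prop :=
  ContDiff ℝ (⊤ : ℕ∞) ψ ∧ HasCompactSupport ψ ∧ tsupport ψ ⊆ Ω

/-- `Ω` is a smooth bounded open subset of `ℝ^N`. -/
def IsSmoothDomain {N : ℕ} (Ω : Set (Euc N)) : Prop :=
  IsOpen Ω ∧ Bornology.IsBounded Ω ∧
    ∃ f : Euc N → ℝ, ContDiff ℝ (⊤ : ℕ∞) f ∧ Ω = {x | f x < 0} ∧
      ∀ x ∈ frontier Ω, fderiv ℝ f x ≠ 0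

theorem EuclideanSpace.hasFDerivAt_norm {N : ℕ} {x : Euc N} (hx : x ≠ 0) :
    HasFDerivAt (fun y : Euc N => ‖y‖) (‖x‖⁻¹ • innerSL ℝ x) x := by
  have h1 := (hasStrictFDerivAt_norm_sq x).hasFDerivAt.sqrt
    (pow_ne_zero 2 (norm_ne_zero_iff.2 hx))
  simp only [Real.sqrt_sq (norm_nonneg _)] at h1
  have h2 : ‖x‖⁻¹ • innerSL ℝ x = (1 / (2 * ‖x‖)) • 2 • innerSL ℝ x := by
    ext v
    simp
    ring
  exact h2 ▸ h1

theorem pderiv'_eq_of_hasFDerivAt {N : ℕ} {f : Euc N → ℝ} {L : Euc N →L[ℝ] ℝ} {x : Euc N}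
    (hf : HasFDerivAt f L x) (i : Fin N) :
    pderiv' i f x = L (EuclideanSpace.single i 1) := by
  rw [pderiv', hf.fderiv]

theorem pderiv'_comp_norm {N : ℕ} {φ : ℝ → ℝ} {d : ℝ} {x : Euc N} (hx : x ≠ 0)
    (hφ : HasDerivAt φ d ‖x‖) (i : Fin N) :
    pderiv' i (fun y => φ ‖y‖) x = d / ‖x‖ * x i := by
  have h1 : HasFDerivAt (fun y : Euc N => φ ‖y‖) _ x :=
    hφ.comp_hasFDerivAt x (EuclideanSpace.hasFDerivAt_norm hx)
  rw [pderiv'_eq_of_hasFDerivAt h1]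
  simp [EuclideanSpace.inner_single_right]
  ring

theorem pderiv'_comp_norm_mul_coord {N : ℕ} {φ : ℝ → ℝ} {d : ℝ} {x : Euc N} (hx : x ≠ 0)
    (hφ : HasDerivAt φ d ‖x‖) (i j : Fin N) :
    pderiv' i (fun y => φ ‖y‖ * y j) x =
      φ ‖x‖ * (if i = j then 1 else 0) + d / ‖x‖ * (x i * x j) := by
  have hc : HasFDerivAt (fun y : Euc N => y j) (EuclideanSpace.proj (𝕜 := ℝ) j) x :=
    (EuclideanSpace.proj (𝕜 := ℝ) j).hasFDerivAt
  have h1 : HasFDerivAt (fun y : Euc N => φ ‖y‖ * y j) _ x :=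
    (hφ.comp_hasFDerivAt x (EuclideanSpace.hasFDerivAt_norm hx)).mul hc
  rw [pderiv'_eq_of_hasFDerivAt h1]
  simp [EuclideanSpace.inner_single_right, eq_comm]
  ring

theorem pderiv'_congr {N : ℕ} {f f' : Euc N → ℝ} {x : Euc N} (hf : f =ᶠ[𝓝 x] f') (i : Fin N) :
    pderiv' i f x = pderiv' i f' x := by
  rw [pderiv', pderiv', hf.fderiv_eq]

/-- The Hessian of a radial function away from the origin. -/
theorem pderiv'_pderiv'_comp_norm {N : ℕ} {φ k : ℝ → ℝ} {d : ℝ} {x : Euc N} (hx : x ≠ 0)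
    (hφ : ∀ t, 0 < t → HasDerivAt φ (k t * t) t) (hk : HasDerivAt k d ‖x‖) (i j : Fin N) :
    pderiv' i (pderiv' j fun y => φ ‖y‖) x =
      k ‖x‖ * (if i = j then 1 else 0) + d / ‖x‖ * (x i * x j) := by
  rw [← pderiv'_comp_norm_mul_coord hx hk]
  refine pderiv'_congr ?_ i
  filter_upwards [isOpen_ne.mem_nhds hx] with y hy
  have hy' : ‖y‖ ≠ 0 := norm_ne_zero_iff.2 hy
  rw [pderiv'_comp_norm hy (hφ _ (norm_pos_iff.2 hy)), mul_div_cancel_right₀ _ hy']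

theorem det_smul_one_add_smul_vecMulVec {q : ℕ} (hq : 1 ≤ q) (c d : ℝ) (v : Fin (q + 1) → ℝ) :
    (c • (1 : Matrix (Fin (q + 1)) (Fin (q + 1)) ℝ) + d • Matrix.vecMulVec v v).det =
      c ^ (q + 1) + d * c ^ q * ∑ i, v i ^ 2 := by
  rcases eq_or_ne c 0 with rfl | hc
  · have : Nontrivial (Fin (q + 1)) := Fin.nontrivial_iff_two_le.2 (by omega)
    have hq0 : q ≠ 0 := by omega
    simp [Matrix.det_vecMulVec, hq0]
  · have h1 : c • (1 : Matrix (Fin (q + 1)) (Fin (q + 1)) ℝ) + d • Matrix.vecMulVec v v =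
        c • (1 + Matrix.replicateCol Unit ((d / c) • v) * Matrix.replicateRow Unit v) := by
      ext i j
      simp [Matrix.mul_apply, Matrix.vecMulVec_apply]
      field_simp
    rw [h1, Matrix.det_smul, Matrix.det_one_add_replicateCol_mul_replicateRow]
    simp only [dotProduct, Pi.smul_apply, smul_eq_mul, Fintype.card_fin, mul_add,
      Finset.mul_sum, mul_one]
    congr 1
    refine Finset.sum_congr rfl fun i _ => ?_
    field_simp
    ring

theorem integral_radial_mul_coord_sq_eq {N : ℕ} (F : ℝ → ℝ) (i j : Fin N) :
    ∫ x : Euc N, F ‖x‖ * x i ^ 2 = ∫ x : Euc N, F ‖x‖ * x j ^ 2 := by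
  let e := LinearIsometryEquiv.piLpCongrLeft 2 ℝ ℝ (Equiv.swap i j)
  have := e.measurePreserving.integral_comp e.toHomeomorph.measurableEmbedding
    fun x : Euc N => F ‖x‖ * x j ^ 2
  rw [← this]
  refine integral_congr_ae (Eventually.of_forall fun x => ?_)
  simp [e, LinearIsometryEquiv.piLpCongrLeft_apply]

theorem integrable_radial_mul {N : ℕ} {F : ℝ → ℝ} (hF : Continuous F)
    (hF1 : ∀ t, 1 ≤ t → F t = 0) {u : Euc N → ℝ} (hu : Continuous u) :
    Integrable fun x : Euc N => F ‖x‖ * u x := by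
  refine Continuous.integrable_of_hasCompactSupport (by fun_prop)
    (HasCompactSupport.intro (isCompact_closedBall (0 : Euc N) 1) fun x hx => ?_)
  simp only [Metric.mem_closedBall, dist_zero_right, not_le] at hx
  simp [hF1 _ hx.le]

theorem integral_radial_mul_coord_sq {N : ℕ} (hN : N ≠ 0) {F : ℝ → ℝ} (hF : Continuous F)
    (hF1 : ∀ t, 1 ≤ t → F t = 0) (i : Fin N) :
    ∫ x : Euc N, F ‖x‖ * x i ^ 2 = (1 / N : ℝ) * ∫ x : Euc N, F ‖x‖ * ‖x‖ ^ 2 := by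
  have h1 : ∫ x : Euc N, F ‖x‖ * ‖x‖ ^ 2 = ∑ j : Fin N, ∫ x : Euc N, F ‖x‖ * x j ^ 2 := by
    rw [← integral_finsetSum _ fun j _ => integrable_radial_mul hF hF1 (by fun_prop)]
    simp only [EuclideanSpace.real_norm_sq_eq, Finset.mul_sum]
  rw [h1, Finset.sum_congr rfl fun j _ => integral_radial_mul_coord_sq_eq F j i]
  simp
  field_simp

theorem continuous_div_pow_of_eventuallyEq_zero {φ : ℝ → ℝ} (hφ : Continuous φ)
    (h0 : φ =ᶠ[𝓝 0] 0) (m : ℕ) : Continuous fun t => φ t / t ^ m := by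
  refine continuous_iff_continuousAt.2 fun t => ?_
  rcases eq_or_ne t 0 with rfl | ht
  · have : (fun t => φ t / t ^ m) =ᶠ[𝓝 0] fun _ => (0 : ℝ) := by
      filter_upwards [h0] with y hy
      simp [hy]
    exact continuousAt_const.congr this.symm
  · exact hφ.continuousAt.div (by fun_prop) (pow_ne_zero m ht)

/-- Integration by parts for the radial profile of a Hessian minor. -/
theorem integral_radial_minor_profile {h : ℝ → ℝ} (hh : ContDiff ℝ 1 h) (h1 : h 1 = 0)
    (p q n s : ℕ) (hpq : p + s = q + 1 + n) :
    ∫ t in (0 : ℝ)..1, t ^ p * ((h t / t) ^ (q + 1) * t ^ s + ((q + 1 : ℕ) : ℝ) *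
        ((1 / (p + 1 : ℕ) : ℝ) *
          ((h t / t) ^ q * ((deriv h t * t - h t) / t ^ 3) * t ^ s * t ^ 2))) =
      -(s / (p + 1 : ℕ) : ℝ) * ∫ t in (0 : ℝ)..1, h t ^ (q + 1) * t ^ n := by
  have hd : ∀ t, HasDerivAt h (deriv h t) t := fun t =>
    (hh.differentiable (by norm_num) t).hasDerivAt
  have hc : Continuous h := hh.continuous
  have hc' : Continuous (deriv h) := hh.continuous_deriv le_rfl
  have hs : (s : ℝ) = q + 1 + n - p := by
    have : ((p + s : ℕ) : ℝ) = (q + 1 + n : ℕ) := by rw [hpq]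
    push_cast at this
    linarith
  have hp : (p + 1 : ℝ) ≠ 0 := by positivity
  have hΦ : ∀ t, HasDerivAt (fun t => (1 / (p + 1 : ℝ)) * (h t ^ (q + 1) * t ^ (n + 1)))
      ((1 / (p + 1 : ℝ)) * (((q + 1 : ℕ) * h t ^ q * deriv h t) * t ^ (n + 1) +
        h t ^ (q + 1) * ((n + 1 : ℕ) * t ^ n))) t := fun t => by
    simpa using (((hd t).pow (q + 1)).mul (hasDerivAt_pow (n + 1) t)).const_mul (1 / (p + 1 : ℝ))
  have hI := intervalIntegral.integral_eq_sub_of_hasDerivAt (a := 0) (b := 1)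
    (fun t _ => hΦ t) (Continuous.intervalIntegrable (by fun_prop) _ _)
  simp only [h1, ne_eq, Nat.succ_ne_zero, not_false_eq_true, zero_pow, zero_mul, mul_zero,
    sub_zero] at hI
  rw [← intervalIntegral.integral_const_mul]
  refine Eq.trans ?_ ((congrArg (_ + ·) hI).trans (add_zero _))
  rw [← intervalIntegral.integral_add (Continuous.intervalIntegrable (by fun_prop) _ _)
    (Continuous.intervalIntegrable (by fun_prop) _ _)]
  refine intervalIntegral.integral_congr_ae (Eventually.of_forall fun t ht => ?_)
  rw [Set.uIoc_of_le zero_le_one] at ht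
  have ht0 : t ≠ 0 := ht.1.ne'
  have hA : t ^ p * ((h t / t) ^ (q + 1) * t ^ s) = h t ^ (q + 1) * t ^ n := by
    have : t ^ p * t ^ s = t ^ (q + 1) * t ^ n := by rw [← pow_add, hpq, pow_add]
    rw [div_pow]
    field_simp
    linear_combination h t ^ (q + 1) * this
  have hB : t ^ p * ((h t / t) ^ q * ((deriv h t * t - h t) / t ^ 3) * t ^ s * t ^ 2) =
      h t ^ q * (deriv h t * t - h t) * t ^ n := by
    have : t ^ p * t ^ s = t ^ (q + 1) * t ^ n := by rw [← pow_add, hpq, pow_add]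
    rw [div_pow]
    field_simp
    rw [pow_succ] at this
    linear_combination h t ^ q * (deriv h t * t - h t) * this
  rw [mul_add, hA, hs]
  push_cast
  linear_combination ((q + 1 : ℝ) / (p + 1)) * hB - h t ^ (q + 1) * t ^ n * mul_inv_cancel₀ hp

/-- Lemma 4.3: for `g(x) = ∫_0^{|x|} h`, with `h ∈ C_c^∞((0,1))` of zero mean and
`∫_0^1 h^r ρ^{-r+N+s-1} dρ ≠ 0`, all the principal `r × r` Hessian minors satisfy
`∫_{B(0,1)} M_α^α(D^2 g) |x|^s dx ≠ 0`. -/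
theorem stmt12 (N r s : ℕ) (hN : 2 ≤ N) (hr : 2 ≤ r) (hrN : r ≤ N) (hs : 1 ≤ s)
    (h : ℝ → ℝ) (hsm : ContDiff ℝ (⊤ : ℕ∞) h) (hsupp : tsupport h ⊆ Set.Ioo 0 1)
    (hmean : (∫ ρ in (0:ℝ)..1, h ρ) = 0)
    (hnz : (∫ ρ in (0:ℝ)..1, h ρ ^ r * ρ ^ ((N : ℤ) + s - r - 1)) ≠ 0)
    (g : Euc N → ℝ) (hg : ∀ x, g x = ∫ ρ in (0:ℝ)..‖x‖, h ρ)
    (α : Fin r → Fin N) (hα : StrictMono α) :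
    (∫ x in Metric.ball (0 : Euc N) 1,
      Matrix.det (Matrix.of fun a b : Fin r => pderiv' (α a) (pderiv' (α b) g) x) *
        ‖x‖ ^ s) ≠ 0 := by
  obtain ⟨p, rfl⟩ : ∃ p, N = p + 1 := ⟨N - 1, by omega⟩
  obtain ⟨q, rfl⟩ : ∃ q, r = q + 1 := ⟨r - 1, by omega⟩
  obtain ⟨n, hn⟩ : ∃ n, p + s = q + 1 + n := ⟨p + s - q - 1, by omega⟩
  have hz : ((p + 1 : ℕ) : ℤ) + s - (q + 1 : ℕ) - 1 = n := by
    push_cast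
    omega
  simp only [hz, zpow_natCast] at hnz
  have hC : Continuous h := hsm.continuous
  have hsm1 : ContDiff ℝ 1 h := hsm.of_le (by exact_mod_cast le_top)
  have hC' : Continuous (deriv h) := hsm1.continuous_deriv le_rfl
  have hout : ∀ t, t ∉ Set.Ioo (0 : ℝ) 1 → h t = 0 ∧ deriv h t = 0 := fun t ht =>
    ⟨image_eq_zero_of_notMem_tsupport fun h' => ht (hsupp h'),
      image_eq_zero_of_notMem_tsupport fun h' => ht (hsupp (tsupport_deriv_subset h'))⟩
  have h1 : ∀ t, 1 ≤ t → h t = 0 ∧ deriv h t = 0 := fun t ht =>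
    hout t fun h' => absurd h'.2 ht.not_gt
  have hev : h =ᶠ[𝓝 0] 0 := notMem_tsupport_iff_eventuallyEq.1 fun h' => lt_irrefl _ (hsupp h').1
  set k : ℝ → ℝ := fun t => h t / t with hkdef
  set A : ℝ → ℝ := fun t => (h t / t) ^ (q + 1) * t ^ s with hA
  set B : ℝ → ℝ := fun t => (h t / t) ^ q * ((deriv h t * t - h t) / t ^ 3) * t ^ s with hB
  have hkc : Continuous fun t => h t / t := by
    simpa using continuous_div_pow_of_eventuallyEq_zero hC hev 1
  have hAc : Continuous A := by fun_prop
  have hBc : Continuous B := by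
    have : Continuous fun t => (deriv h t * t - h t) / t ^ 3 := by
      refine continuous_div_pow_of_eventuallyEq_zero (by fun_prop) ?_ 3
      filter_upwards [hev, hev.deriv] with t ht ht'
      simp [ht, ht']
    fun_prop
  have hA1 : ∀ t, 1 ≤ t → A t = 0 := fun t ht => by simp [hA, (h1 t ht).1]
  have hB1 : ∀ t, 1 ≤ t → B t = 0 := fun t ht => by simp [hB, (h1 t ht).1, (h1 t ht).2]
  have hdet : ∀ x : Euc (p + 1),
      Matrix.det (Matrix.of fun a b : Fin (q + 1) => pderiv' (α a) (pderiv' (α b) g) x) *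
        ‖x‖ ^ s = A ‖x‖ * 1 + ∑ a, B ‖x‖ * x (α a) ^ 2 := by
    intro x
    rcases eq_or_ne x 0 with rfl | hx
    · have : s ≠ 0 := by omega
      simp [hA, hB, this]
    have hx0 : ‖x‖ ≠ 0 := norm_ne_zero_iff.2 hx
    have hk : HasDerivAt k ((deriv h ‖x‖ * ‖x‖ - h ‖x‖ * 1) / ‖x‖ ^ 2) ‖x‖ :=
      ((hsm1.differentiable (by norm_num) _).hasDerivAt).div (hasDerivAt_id _) hx0
    have hφ : ∀ t, 0 < t → HasDerivAt (fun t => ∫ ρ in (0 : ℝ)..t, h ρ) (k t * t) t := by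
      intro t ht
      rw [hkdef, div_mul_cancel₀ _ ht.ne']
      exact intervalIntegral.integral_hasDerivAt_right (hC.intervalIntegrable _ _)
        (hC.stronglyMeasurableAtFilter _ _) hC.continuousAt
    have hgf : g = fun y => ∫ ρ in (0 : ℝ)..‖y‖, h ρ := funext hg
    have hM : (Matrix.of fun a b : Fin (q + 1) => pderiv' (α a) (pderiv' (α b) g) x) =
        k ‖x‖ • (1 : Matrix (Fin (q + 1)) (Fin (q + 1)) ℝ) +
          ((deriv h ‖x‖ * ‖x‖ - h ‖x‖ * 1) / ‖x‖ ^ 2 / ‖x‖) •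
            Matrix.vecMulVec (fun a => x (α a)) (fun a => x (α a)) := by
      ext a b
      rw [Matrix.of_apply, hgf, pderiv'_pderiv'_comp_norm hx hφ hk]
      simp [Matrix.one_apply, Matrix.vecMulVec_apply, hα.injective.eq_iff]
    rw [hM, det_smul_one_add_smul_vecMulVec (by omega), ← Finset.mul_sum]
    simp only [hA, hB, hkdef]
    field_simp
  have hN0 : (p + 1 : ℕ) ≠ 0 := by omega
  have hAi : Integrable fun x : Euc (p + 1) => A ‖x‖ * 1 :=
    integrable_radial_mul hAc hA1 continuous_const
  have hBi : ∀ a, Integrable fun x : Euc (p + 1) => B ‖x‖ * x (α a) ^ 2 := fun a =>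
    integrable_radial_mul hBc hB1 (by fun_prop)
  have hBn : Integrable fun x : Euc (p + 1) => B ‖x‖ * ‖x‖ ^ 2 :=
    integrable_radial_mul hBc hB1 (by fun_prop)
  have hred : (∫ x in Metric.ball (0 : Euc (p + 1)) 1,
      Matrix.det (Matrix.of fun a b : Fin (q + 1) => pderiv' (α a) (pderiv' (α b) g) x) *
        ‖x‖ ^ s) = ∫ x : Euc (p + 1), (fun t => A t + ((q + 1 : ℕ) : ℝ) *
          ((1 / (p + 1 : ℕ) : ℝ) * (B t * t ^ 2))) ‖x‖ := by
    simp only [hdet]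
    rw [setIntegral_eq_integral_of_forall_compl_eq_zero, integral_add hAi
      (integrable_finsetSum _ fun a _ => hBi a), integral_finsetSum _ fun a _ => hBi a,
      Finset.sum_congr rfl fun a _ => integral_radial_mul_coord_sq hN0 hBc hB1 (α a)]
    · simp only [mul_one] at hAi ⊢
      rw [integral_add hAi ((hBn.const_mul _).const_mul _), integral_const_mul,
        integral_const_mul, Finset.sum_const, Finset.card_univ, Fintype.card_fin, nsmul_eq_mul]
    · intro x hx
      simp only [Metric.mem_ball, dist_zero_right, not_lt] at hx
      simp [hA1 _ hx, hB1 _ hx]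
  rw [hred, integral_fun_norm_addHaar volume (fun t => A t + ((q + 1 : ℕ) : ℝ) *
    ((1 / (p + 1 : ℕ) : ℝ) * (B t * t ^ 2)))]
  have hIoi : ∫ t in Set.Ioi (0 : ℝ), t ^ (Module.finrank ℝ (Euc (p + 1)) - 1) •
      (A t + ((q + 1 : ℕ) : ℝ) * ((1 / (p + 1 : ℕ) : ℝ) * (B t * t ^ 2))) =
      -(s / (p + 1 : ℕ) : ℝ) * ∫ t in (0 : ℝ)..1, h t ^ (q + 1) * t ^ n := by
    rw [← integral_radial_minor_profile hsm1 (h1 1 le_rfl).1 p q n s hn,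
      intervalIntegral.integral_of_le zero_le_one]
    simp only [finrank_euclideanSpace, Fintype.card_fin, Nat.add_sub_cancel, smul_eq_mul]
    refine setIntegral_eq_of_subset_of_forall_sdiff_eq_zero measurableSet_Ioi
      Set.Ioc_subset_Ioi_self fun t ht => ?_
    have ht1 : 1 ≤ t := by
      by_contra hlt
      exact ht.2 ⟨ht.1, (not_le.1 hlt).le⟩
    simp [hA1 t ht1, hB1 t ht1]
  rw [hIoi]
  have hvol : volume.real (Metric.ball (0 : Euc (p + 1)) 1) ≠ 0 :=
    (ENNReal.toReal_pos (Metric.measure_ball_pos _ _ one_pos).ne' measure_ball_lt_top.ne).ne'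
  have hs0 : (s : ℝ) ≠ 0 := by positivity
  have hp0 : ((p + 1 : ℕ) : ℝ) ≠ 0 := by positivity
  rw [finrank_euclideanSpace, Fintype.card_fin, nsmul_eq_mul, smul_eq_mul]
  exact mul_ne_zero hp0 (mul_ne_zero hvol (mul_ne_zero (neg_ne_zero.2 (div_ne_zero hs0 hp0)) hnz))
end
end

section
/- Let N ≥ 2, r ≥ 2 and s ≥ 1 be integers with r ≤ N. Let h ∈ C_c^∞((0,1)) satisfy ∫_0^1 h(ρ) dρ = 0, and define g : ℝ^N → ℝ by g(x) = ∫_0^{|x|} h(ρ) dρ. Then for every α ∈ I(r,N): ∫_{B(0,1)} M_α^α(D^2 g(x)) |x|^s dx = −(s/N) · 2π · (∏_{i=1}^{N−2} ∫_0^π sin^i θ dθ) · ∫_0^1 h(ρ)^r ρ^{−r+N+s−1} dρ (the product over i is empty, hence equal to 1, when N = 2). Here M_α^α(D^2 g) denotes the determinant of the r×r submatrix of the Hessian matrix D^2 g obtained by selecting the rows and columns indexed by α. -/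
open MeasureTheory Filter Topology Real

noncomputable section

theorem prod_integral_sin_pow_consecutive (n : ℕ) :
    (∫ θ in (0:ℝ)..Real.pi, Real.sin θ ^ n) * (∫ θ in (0:ℝ)..Real.pi, Real.sin θ ^ (n + 1)) =
      2 * Real.pi / (n + 1) := by
  induction n with
  | zero => simp [mul_comm]; norm_num
  | succ k ih =>
    rw [integral_sin_pow k]
    have h1 : (k:ℝ) + 2 ≠ 0 := by positivity
    have h2 : (k:ℝ) + 1 ≠ 0 := by positivity
    simp only [Real.sin_zero, Real.sin_pi, ne_eq, Nat.succ_ne_zero, not_false_eq_true, zero_pow,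
      zero_mul, sub_zero, zero_div, zero_add]
    rw [mul_left_comm, mul_comm (∫ θ in (0:ℝ)..Real.pi, Real.sin θ ^ (k + 1)), ih]
    push_cast
    field_simp
    ring

theorem card_mul_volume_unitBall (N : ℕ) (hN : 0 < N) :
    (N : ℝ) * (volume : Measure (Euc N)).real (Metric.ball 0 1) =
      2 * (√Real.pi ^ N / Real.Gamma ((N : ℝ) / 2)) := by
  have : Nonempty (Fin N) := ⟨⟨0, hN⟩⟩
  have hN' : (0:ℝ) < N := by exact_mod_cast hN
  rw [Measure.real, EuclideanSpace.volume_ball]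
  have hG : 0 < Real.Gamma ((N : ℝ) / 2) := Real.Gamma_pos_of_pos (by positivity)
  have hG' : 0 < Real.Gamma ((N : ℝ) / 2 + 1) := Real.Gamma_pos_of_pos (by positivity)
  simp only [ENNReal.ofReal_one, one_pow, one_mul, Fintype.card_fin]
  rw [ENNReal.toReal_ofReal (by positivity), Real.Gamma_add_one (by positivity)]
  field_simp

theorem two_pi_mul_prod_integral_sin_pow (N : ℕ) :
    2 * Real.pi * ∏ i ∈ Finset.Icc 1 N, ∫ θ in (0:ℝ)..Real.pi, Real.sin θ ^ i =
      2 * (√Real.pi ^ (N + 2) / Real.Gamma (((N + 2 : ℕ) : ℝ) / 2)) := by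
  have hpi : √Real.pi ^ 2 = Real.pi := Real.sq_sqrt Real.pi_pos.le
  have hsp : 0 < √Real.pi := Real.sqrt_pos.2 Real.pi_pos
  induction N using Nat.twoStepInduction with
  | zero => simp [hpi]
  | one =>
    have : (((1 + 2 : ℕ) : ℝ) / 2) = 1 / 2 + 1 := by norm_num
    rw [this, Real.Gamma_add_one (by norm_num), Real.Gamma_one_half_eq]
    simp only [Finset.Icc_self, Finset.prod_singleton, pow_one, integral_sin]
    simp only [Real.cos_zero, Real.cos_pi]
    field_simp
    rw [pow_add, hpi]
    ring
  | more n ih _ =>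
    rw [Finset.prod_Icc_succ_top (by omega), Finset.prod_Icc_succ_top (by omega), mul_assoc (∏ k ∈ _, _),
      ← mul_assoc (2 * Real.pi), ih, prod_integral_sin_pow_consecutive]
    have : (((n + 2 + 2 : ℕ) : ℝ) / 2) = ((n + 2 : ℕ) : ℝ) / 2 + 1 := by push_cast; ring
    rw [this, Real.Gamma_add_one (by positivity)]
    have hG : 0 < Real.Gamma (((n + 2 : ℕ) : ℝ) / 2) := Real.Gamma_pos_of_pos (by positivity)
    rw [pow_add _ (n + 2) 2, hpi]
    have h3 : (n:ℝ) + 2 ≠ 0 := by positivity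
    have h4 : (n:ℝ) + 1 + 1 ≠ 0 := by positivity
    push_cast at hG ⊢
    field_simp
    ring

theorem integral_radial_mul_coord_sq_s13 {N : ℕ} (f : ℝ → ℝ) (hf : Continuous f)
    (hsupp : tsupport f ⊆ Set.Ioo 0 1) (i : Fin N) :
    Integrable (fun x : Euc N => f ‖x‖ * x i ^ 2) ∧
      (N : ℝ) * ∫ x : Euc N, f ‖x‖ * x i ^ 2 = ∫ x : Euc N, f ‖x‖ * ‖x‖ ^ 2 := by
  have hint : ∀ j : Fin N, Integrable (fun x : Euc N => f ‖x‖ * x j ^ 2) := by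
    intro j
    refine Continuous.integrable_of_hasCompactSupport (by fun_prop) ?_
    refine HasCompactSupport.intro (isCompact_closedBall (0 : Euc N) 1) fun x hx => ?_
    rw [mem_closedBall_zero_iff, not_le] at hx
    rw [image_eq_zero_of_notMem_tsupport fun h => (hsupp h).2.not_gt hx, zero_mul]
  refine ⟨hint i, ?_⟩
  have hsymm : ∀ j : Fin N,
      ∫ x : Euc N, f ‖x‖ * x j ^ 2 = ∫ x : Euc N, f ‖x‖ * x i ^ 2 := by
    intro j
    let e : Euc N ≃ₗᵢ[ℝ] Euc N := LinearIsometryEquiv.piLpCongrLeft 2 ℝ ℝ (Equiv.swap i j)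
    rw [← e.measurePreserving.integral_comp e.toHomeomorph.measurableEmbedding
      fun x => f ‖x‖ * x j ^ 2]
    refine integral_congr_ae (Eventually.of_forall fun x => ?_)
    simp [e, LinearIsometryEquiv.piLpCongrLeft_apply, Equiv.piCongrLeft']
  have hsum : ∫ x : Euc N, f ‖x‖ * ‖x‖ ^ 2 = ∑ j : Fin N, ∫ x : Euc N, f ‖x‖ * x j ^ 2 := by
    rw [← integral_finsetSum _ fun j _ => hint j]
    refine integral_congr_ae (Eventually.of_forall fun x => ?_)
    simp [EuclideanSpace.norm_sq_eq, Finset.mul_sum]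
  rw [hsum, Finset.sum_congr rfl fun j _ => hsymm j]
  simp

theorem det_smul_one_add_smul_vecMulVec_s13 {r : ℕ} (hr : 2 ≤ r) (a c : ℝ) (v : Fin r → ℝ) :
    Matrix.det (Matrix.of fun i j : Fin r => a * (if i = j then 1 else 0) + c * (v i * v j)) =
      a ^ r + a ^ (r - 1) * c * ∑ i, v i ^ 2 := by
  have hr' : r ≠ 0 := by omega
  by_cases ha : a = 0
  · subst ha
    have : Nontrivial (Fin r) := Fin.nontrivial_iff_two_le.2 hr
    have : (Matrix.of fun i j : Fin r => (0:ℝ) * (if i = j then 1 else 0) + c * (v i * v j)) =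
        Matrix.vecMulVec (fun i => c * v i) v := by
      ext i j
      simp [Matrix.vecMulVec_apply, mul_assoc]
    rw [this, Matrix.det_vecMulVec, zero_pow hr', zero_pow (by omega)]
    simp
  · have : (Matrix.of fun i j : Fin r => a * (if i = j then 1 else 0) + c * (v i * v j)) =
        a • (1 + Matrix.replicateCol Unit (fun i => c / a * v i) * Matrix.replicateRow Unit v) := by
      ext i j
      simp only [Matrix.of_apply, Matrix.smul_apply, Matrix.add_apply, Matrix.one_apply,
        Matrix.mul_apply, Matrix.replicateCol_apply, Matrix.replicateRow_apply, smul_eq_mul,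
        Finset.univ_unique, Finset.sum_singleton]
      field_simp
    rw [this, Matrix.det_smul, Matrix.det_one_add_replicateCol_mul_replicateRow, Fintype.card_fin]
    obtain ⟨k, rfl⟩ := Nat.exists_eq_succ_of_ne_zero hr'
    have h2 : (v ⬝ᵥ fun i => c / a * v i) = c / a * ∑ i, v i ^ 2 := by
      simp only [dotProduct, Finset.mul_sum]
      exact Finset.sum_congr rfl fun i _ => by ring
    rw [h2]
    simp only [Nat.succ_eq_add_one, Nat.add_sub_cancel]
    field_simp
    ring

theorem hasFDerivAt_radial {N : ℕ} {f : ℝ → ℝ} {f' : ℝ} {x : Euc N} (hx : x ≠ 0)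
    (hf : HasDerivAt f f' ‖x‖) :
    HasFDerivAt (fun y : Euc N => f ‖y‖) ((f' / ‖x‖) • innerSL ℝ x) x := by
  have hn : ‖x‖ ≠ 0 := norm_ne_zero_iff.2 hx
  have h1 := ((hasStrictFDerivAt_norm_sq x).hasFDerivAt.sqrt (by positivity))
  simp only [Real.sqrt_sq (norm_nonneg _)] at h1
  refine (hf.comp_hasFDerivAt x h1).congr_fderiv ?_
  ext y
  simp
  field_simp

theorem pderiv'_pderiv'_radial {N : ℕ} {G h : ℝ → ℝ} (hG : ∀ ρ, HasDerivAt G (h ρ) ρ)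
    (hh : Differentiable ℝ h) {x : Euc N} (hx : x ≠ 0) (i j : Fin N) :
    pderiv' i (pderiv' j fun y => G ‖y‖) x =
      h ‖x‖ / ‖x‖ * (if i = j then 1 else 0) +
        (deriv h ‖x‖ - h ‖x‖ / ‖x‖) / ‖x‖ ^ 2 * (x i * x j) := by
  have hn : ‖x‖ ≠ 0 := norm_ne_zero_iff.2 hx
  have h1 : pderiv' j (fun y : Euc N => G ‖y‖) =ᶠ[𝓝 x] fun y => h ‖y‖ / ‖y‖ * y j := by
    filter_upwards [isOpen_ne.mem_nhds hx] with y hy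
    rw [pderiv', (hasFDerivAt_radial hy (hG _)).fderiv]
    simp [EuclideanSpace.inner_single_right]
  have h2 := hasFDerivAt_radial (f := fun ρ => h ρ / ρ) hx
    ((hh ‖x‖).hasDerivAt.div (hasDerivAt_id' ‖x‖) hn)
  have h3 : HasFDerivAt (fun y : Euc N => y j) (EuclideanSpace.proj j : Euc N →L[ℝ] ℝ) x :=
    (EuclideanSpace.proj j : Euc N →L[ℝ] ℝ).hasFDerivAt
  rw [pderiv', h1.fderiv_eq, (HasFDerivAt.fun_mul h2 h3).fderiv]
  simp [EuclideanSpace.inner_single_right, eq_comm]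
  field_simp

theorem continuous_of_tsupport_subset_Ioo {f h : ℝ → ℝ} (hsupp : tsupport h ⊆ Set.Ioo 0 1)
    (hf : ContinuousOn f {0}ᶜ) (hfh : ∀ ρ, h ρ = 0 → f ρ = 0) :
    Continuous f ∧ tsupport f ⊆ Set.Ioo 0 1 := by
  have hsub : tsupport f ⊆ Set.Ioo 0 1 :=
    (closure_mono (Function.support_subset_iff'.2 fun ρ hρ => hfh ρ (by simpa using hρ))).trans hsupp
  exact ⟨hf.continuous_of_tsupport_subset isOpen_compl_singleton
    (hsub.trans fun ρ hρ => hρ.1.ne'), hsub⟩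

theorem integrable_radial {N : ℕ} {f : ℝ → ℝ} (hf : Continuous f)
    (hsupp : tsupport f ⊆ Set.Ioo 0 1) : Integrable (fun x : Euc N => f ‖x‖) := by
  refine Continuous.integrable_of_hasCompactSupport (by fun_prop) ?_
  refine HasCompactSupport.intro (isCompact_closedBall (0 : Euc N) 1) fun x hx => ?_
  rw [mem_closedBall_zero_iff, not_le] at hx
  exact image_eq_zero_of_notMem_tsupport fun h => (hsupp h).2.not_gt hx

theorem integral_radial_eq {N : ℕ} (hN : 2 ≤ N) {f : ℝ → ℝ}
    (hsupp : tsupport f ⊆ Set.Ioo 0 1) :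
    ∫ x : Euc N, f ‖x‖ =
      2 * Real.pi * (∏ i ∈ Finset.Icc 1 (N - 2), ∫ θ in (0:ℝ)..Real.pi, Real.sin θ ^ i) *
        ∫ ρ in (0:ℝ)..1, ρ ^ (N - 1) * f ρ := by
  have : Nonempty (Fin N) := ⟨⟨0, by omega⟩⟩
  have hσ := card_mul_volume_unitBall N (by omega)
  rw [integral_fun_norm_addHaar, finrank_euclideanSpace_fin, nsmul_eq_mul, smul_eq_mul,
    ← mul_assoc, hσ, two_pi_mul_prod_integral_sin_pow, Nat.sub_add_cancel hN,
    intervalIntegral.integral_of_le zero_le_one]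
  congr 1
  simp only [smul_eq_mul]
  refine (setIntegral_eq_of_subset_of_forall_sdiff_eq_zero measurableSet_Ioi
    Set.Ioc_subset_Ioi_self fun ρ hρ => ?_)
  rw [image_eq_zero_of_notMem_tsupport (f := f)
    fun h => hρ.2 ⟨(hsupp h).1, (hsupp h).2.le⟩, mul_zero]

theorem integral_pow_mul_radial_minor {N r s : ℕ} (hr : 2 ≤ r) (hrN : r ≤ N) (hs : 1 ≤ s)
    {h : ℝ → ℝ} (hsm : ContDiff ℝ 1 h) (hsupp : tsupport h ⊆ Set.Ioo 0 1) :
    ∫ ρ in (0:ℝ)..1, ρ ^ (N - 1) * ((h ρ / ρ) ^ r * ρ ^ s +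
        (r / N : ℝ) * ((h ρ / ρ) ^ (r - 1) * ((deriv h ρ - h ρ / ρ) / ρ ^ 2) * ρ ^ s * ρ ^ 2)) =
      -((s : ℝ) / N) * ∫ ρ in (0:ℝ)..1, h ρ ^ r * ρ ^ ((N : ℤ) + s - r - 1) := by
  obtain ⟨k, rfl⟩ := Nat.exists_eq_add_of_le' hr
  obtain ⟨p, rfl⟩ := Nat.exists_eq_add_of_le' hrN
  obtain ⟨q, rfl⟩ := Nat.exists_eq_add_of_le' hs
  have hexp : (((p + (k + 2) : ℕ) : ℤ) + (q + 1 : ℕ) - (k + 2 : ℕ) - 1) = ((p + q : ℕ) : ℤ) := by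
    push_cast; ring
  simp only [hexp, zpow_natCast]
  have hc : Continuous h := hsm.continuous
  have hc' : Continuous (deriv h) := hsm.continuous_deriv le_rfl
  have hne : (p : ℝ) + (k + 2) ≠ 0 := by positivity
  let P' : ℝ → ℝ := fun ρ => ((k + 2 : ℕ) * h ρ ^ (k + 1) * deriv h ρ * ρ ^ (p + q + 1) +
    h ρ ^ (k + 2) * ((p + q + 1 : ℕ) * ρ ^ (p + q))) / ((p + (k + 2) : ℕ) : ℝ)
  have hP : ∀ ρ, HasDerivAt
      (fun ρ => h ρ ^ (k + 2) * ρ ^ (p + q + 1) / ((p + (k + 2) : ℕ) : ℝ)) (P' ρ) ρ := fun ρ =>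
    ((((hsm.differentiable one_ne_zero ρ).hasDerivAt.pow (k + 2)).mul
      (hasDerivAt_pow (p + q + 1) ρ)).div_const _)
  have hP'c : Continuous P' := by fun_prop
  have h0 : ∀ c, c + ∫ ρ in (0:ℝ)..1, P' ρ = c := fun c => by
    rw [intervalIntegral.integral_eq_sub_of_hasDerivAt (fun ρ _ => hP ρ)
      (hP'c.intervalIntegrable _ _)]
    have : h 1 = 0 := image_eq_zero_of_notMem_tsupport fun h => (hsupp h).2.false
    simp [this]
  rw [← h0 (-((_ : ℝ) / _) * _), ← intervalIntegral.integral_const_mul,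
    ← intervalIntegral.integral_add (by apply Continuous.intervalIntegrable; fun_prop)
      (hP'c.intervalIntegrable _ _)]
  refine intervalIntegral.integral_congr_ae (Eventually.of_forall fun ρ hρ => ?_)
  rw [Set.uIoc_of_le zero_le_one] at hρ
  have hρ0 : ρ ≠ 0 := hρ.1.ne'
  simp only [P', show p + (k + 2) - 1 = p + k + 1 by omega, show k + 2 - 1 = k + 1 by omega,
    div_pow, pow_add]
  push_cast
  field_simp
  ring

/-- The explicit value of the integrals in Lemma 4.3:
`∫_{B(0,1)} M_α^α(D^2 g) |x|^s dx
  = -(s/N) · 2π · (∏_{i=1}^{N-2} ∫_0^π sin^i θ dθ) · ∫_0^1 h^r ρ^{-r+N+s-1} dρ`. -/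
theorem stmt13 (N r s : ℕ) (hN : 2 ≤ N) (hr : 2 ≤ r) (hrN : r ≤ N) (hs : 1 ≤ s)
    (h : ℝ → ℝ) (hsm : ContDiff ℝ (⊤ : ℕ∞) h) (hsupp : tsupport h ⊆ Set.Ioo 0 1)
    (hmean : (∫ ρ in (0:ℝ)..1, h ρ) = 0)
    (g : Euc N → ℝ) (hg : ∀ x, g x = ∫ ρ in (0:ℝ)..‖x‖, h ρ)
    (α : Fin r → Fin N) (hα : StrictMono α) :
    (∫ x in Metric.ball (0 : Euc N) 1,
      Matrix.det (Matrix.of fun a b : Fin r => pderiv' (α a) (pderiv' (α b) g) x) *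
        ‖x‖ ^ s) =
      -((s : ℝ) / N) * (2 * Real.pi) *
        (∏ i ∈ Finset.Icc 1 (N - 2), ∫ θ in (0:ℝ)..Real.pi, Real.sin θ ^ i) *
        ∫ ρ in (0:ℝ)..1, h ρ ^ r * ρ ^ ((N : ℤ) + s - r - 1) := by
  have hN0 : (N : ℝ) ≠ 0 := by positivity
  have hc : Continuous h := hsm.continuous
  have hsm1 : ContDiff ℝ 1 h := hsm.of_le (by exact_mod_cast le_top)
  have hd : Differentiable ℝ h := hsm1.differentiable one_ne_zero
  have hc' : Continuous (deriv h) := hsm1.continuous_deriv le_rfl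
  have hG : ∀ ρ, HasDerivAt (fun t => ∫ ρ in (0:ℝ)..t, h ρ) (h ρ) ρ := fun ρ =>
    intervalIntegral.integral_hasDerivAt_right (hc.intervalIntegrable _ _)
      (hc.stronglyMeasurableAtFilter _ _) hc.continuousAt
  obtain rfl : g = fun x => ∫ ρ in (0:ℝ)..‖x‖, h ρ := funext hg
  let A : ℝ → ℝ := fun ρ => (h ρ / ρ) ^ r * ρ ^ s
  let B : ℝ → ℝ := fun ρ =>
    (h ρ / ρ) ^ (r - 1) * ((deriv h ρ - h ρ / ρ) / ρ ^ 2) * ρ ^ s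
  have hcont : ContinuousOn (fun ρ => h ρ / ρ) {0}ᶜ :=
    hc.continuousOn.div continuousOn_id fun ρ hρ => hρ
  obtain ⟨hAc, hAs⟩ : Continuous A ∧ tsupport A ⊆ Set.Ioo 0 1 :=
    continuous_of_tsupport_subset_Ioo hsupp ((hcont.pow r).mul (by fun_prop)) fun ρ hρ => by
      simp [A, hρ, show r ≠ 0 by omega]
  obtain ⟨hBc, hBs⟩ : Continuous B ∧ tsupport B ⊆ Set.Ioo 0 1 :=
    continuous_of_tsupport_subset_Ioo hsupp
      (((hcont.pow (r - 1)).mul ((hc'.continuousOn.sub hcont).div (by fun_prop)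
        fun ρ hρ => pow_ne_zero 2 hρ)).mul (by fun_prop)) fun ρ hρ => by
      simp [B, hρ, show r - 1 ≠ 0 by omega]
  have hB2 : Continuous (fun ρ => B ρ * ρ ^ 2) ∧
      tsupport (fun ρ => B ρ * ρ ^ 2) ⊆ Set.Ioo 0 1 :=
    continuous_of_tsupport_subset_Ioo hBs (by fun_prop) fun ρ hρ => by simp [hρ]
  have hF : Continuous (fun ρ => A ρ + (r / N : ℝ) * (B ρ * ρ ^ 2)) ∧
      tsupport (fun ρ => A ρ + (r / N : ℝ) * (B ρ * ρ ^ 2)) ⊆ Set.Ioo 0 1 :=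
    continuous_of_tsupport_subset_Ioo hsupp (by fun_prop) fun ρ hρ => by
      simp [A, B, hρ, show r ≠ 0 by omega, show r - 1 ≠ 0 by omega]
  have hpt : ∀ᵐ x : Euc N,
      Matrix.det (Matrix.of fun a b : Fin r =>
        pderiv' (α a) (pderiv' (α b) fun x => ∫ ρ in (0:ℝ)..‖x‖, h ρ) x) * ‖x‖ ^ s =
      A ‖x‖ + ∑ a, B ‖x‖ * x (α a) ^ 2 := by
    have : Nonempty (Fin N) := ⟨⟨0, by omega⟩⟩
    filter_upwards [compl_mem_ae_iff.2 (measure_singleton (0 : Euc N))] with x hx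
    simp only [pderiv'_pderiv'_radial hG hd hx, hα.injective.eq_iff]
    rw [det_smul_one_add_smul_vecMulVec_s13 hr _ _ fun a => x (α a), ← Finset.mul_sum]
    simp only [A, B]
    ring
  rw [setIntegral_congr_ae (g := fun x : Euc N => A ‖x‖ + ∑ a, B ‖x‖ * x (α a) ^ 2)
      measurableSet_ball (hpt.mono fun x hx _ => hx),
    setIntegral_eq_integral_of_forall_compl_eq_zero]
  · have hBi := fun i => integral_radial_mul_coord_sq_s13 (N := N) B hBc hBs i
    have hBe : ∀ i : Fin N, ∫ x : Euc N, B ‖x‖ * x i ^ 2 =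
        (N : ℝ)⁻¹ * ∫ x : Euc N, B ‖x‖ * ‖x‖ ^ 2 := fun i => by
      rw [← (hBi i).2, inv_mul_cancel_left₀ hN0]
    rw [integral_add (integrable_radial hAc hAs)
      (integrable_finsetSum _ fun a _ => (hBi (α a)).1),
      integral_finsetSum _ fun a _ => (hBi (α a)).1]
    simp only [hBe, Finset.sum_const, Finset.card_univ, Fintype.card_fin, nsmul_eq_mul]
    rw [← mul_assoc, ← div_eq_mul_inv, ← integral_const_mul,
      ← integral_add (integrable_radial hAc hAs)
        ((integrable_radial (f := fun ρ => B ρ * ρ ^ 2) hB2.1 hB2.2).const_mul _),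
      integral_radial_eq hN (f := fun ρ => A ρ + (r / N : ℝ) * (B ρ * ρ ^ 2)) hF.2,
      integral_pow_mul_radial_minor hr hrN hs hsm1 hsupp]
    ring
  · intro x hx
    rw [mem_ball_zero_iff, not_lt] at hx
    have hA0 : A ‖x‖ = 0 := image_eq_zero_of_notMem_tsupport fun h => (hAs h).2.not_ge hx
    have hB0 : B ‖x‖ = 0 := image_eq_zero_of_notMem_tsupport fun h => (hBs h).2.not_ge hx
    simp [hA0, hB0]
end
end

section
/- Let m ∈ {1, 2}, let Ω ⊂ ℝ^N (N ≥ 2) be a smooth bounded open set with (−8,8)^N ⊂ Ω, let n ≥ 1 and r be integers with 1 < r ≤ min{n,N}, and let 1 < p < ∞ and 0 < s < ∞ be such that W^{s,p}(Ω,ℝ^n) is not contained in W^{m−m/r,r}(Ω,ℝ^n); equivalently, s − m + m/r < max{0, N/p − N/r}, or (p > r and s = m − m/r is not an integer). Then there exist a sequence {u_k} ⊂ C^m(Ω̄, ℝ^n), multi-indices β ∈ I(r,n) and 𝛂 = (α^1,…,α^m) with α^j ∈ I(r,N), and a function ψ ∈ C_c^∞(Ω) such that ‖u_k‖_{W^{s,p}(Ω)}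 → 0 and ∫_Ω M^β_𝛂(D^m u_k) ψ dx → +∞ as k → ∞. -/
open MeasureTheory Filter Topology Real

noncomputable section

/-! ### Geometric sums and the critical kernel -/

lemma sum_pow_mul_le_of_one_lt {b t : ℝ} (hb : 1 < b) (ht : 0 ≤ t) (S : Finset ℕ)
    (hS : ∀ l ∈ S, b ^ l * t ≤ 1) : ∑ l ∈ S, b ^ l * t ≤ b / (b - 1) := by
  have hb0 : 0 < b - 1 := by linarith
  rcases S.eq_empty_or_nonempty with rfl | hne
  · simpa using div_nonneg (by linarith) hb0.le
  set M := S.max' hne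
  have hsub : S ⊆ Finset.range (M + 1) := fun l hl =>
    Finset.mem_range.2 (Nat.lt_succ_of_le (S.le_max' l hl))
  calc ∑ l ∈ S, b ^ l * t ≤ ∑ l ∈ Finset.range (M + 1), b ^ l * t :=
        Finset.sum_le_sum_of_subset_of_nonneg hsub fun _ _ _ => by positivity
    _ = (b ^ (M + 1) - 1) / (b - 1) * t := by rw [← Finset.sum_mul, geom_sum_eq hb.ne']
    _ ≤ b / (b - 1) := by
        rw [div_mul_eq_mul_div]
        gcongr
        have := hS M (S.max'_mem hne)
        rw [pow_succ]
        nlinarith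

lemma sum_pow_mul_le_of_lt_one {c t : ℝ} (hc0 : 0 ≤ c) (hc : c < 1) (S : Finset ℕ)
    (ht : 0 ≤ t) (hS : ∀ l ∈ S, c ^ l * t ≤ 1) : ∑ l ∈ S, c ^ l * t ≤ 1 / (1 - c) := by
  have hc1 : 0 < 1 - c := by linarith
  rcases S.eq_empty_or_nonempty with rfl | hne
  · simpa using hc.le
  set M := S.min' hne
  have hM : ∀ l ∈ S, M ≤ l := fun l hl => S.min'_le l hl
  have h1 : ∑ l ∈ S, c ^ (l - M) ≤ 1 / (1 - c) := by
    rw [one_div, ← tsum_geometric_of_lt_one hc0 hc]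
    have hinj : Set.InjOn (fun l => l - M) (S : Set ℕ) := by
      intro x hx y hy hxy
      have := hM x hx
      have := hM y hy
      simp only at hxy
      omega
    rw [← Finset.sum_image (f := fun l => c ^ l) hinj]
    exact (summable_geometric_of_lt_one hc0 hc).sum_le_tsum _ fun _ _ => by positivity
  calc ∑ l ∈ S, c ^ l * t = ∑ l ∈ S, c ^ (l - M) * (c ^ M * t) := by
        refine Finset.sum_congr rfl fun l hl => ?_
        rw [← mul_assoc, ← pow_add, Nat.sub_add_cancel (hM l hl)]
    _ = (∑ l ∈ S, c ^ (l - M)) * (c ^ M * t) := by rw [Finset.sum_mul]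
    _ ≤ (1 / (1 - c)) * 1 := by
        gcongr
        exact hS M (S.min'_mem hne)
    _ = 1 / (1 - c) := mul_one _

/-- The profile `t ↦ min(t^{-σ}, t^{1-σ})` of the Hölder quotients of a unit-scale function. -/
def critProfile (σ t : ℝ) : ℝ := min (t ^ (-σ)) (t ^ (1 - σ))

lemma critProfile_nonneg {σ t : ℝ} (ht : 0 ≤ t) : 0 ≤ critProfile σ t :=
  le_min (rpow_nonneg ht _) (rpow_nonneg ht _)

lemma critProfile_eq {σ t : ℝ} (ht : 0 < t) : critProfile σ t = min 1 t * t ^ (-σ) := by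
  have h1 : t ^ (1 - σ) = t * t ^ (-σ) := by
    rw [sub_eq_add_neg, rpow_add ht, rpow_one]
  rw [critProfile, h1, min_mul_of_nonneg _ _ (rpow_nonneg ht.le _), one_mul]

lemma measurable_critProfile (σ : ℝ) : Measurable (critProfile σ) := by
  unfold critProfile
  fun_prop

lemma sum_critProfile_le {σ : ℝ} (h0 : 0 < σ) (h1 : σ < 1) :
    ∃ C : ℝ, 0 < C ∧ ∀ (S : Finset ℕ) (h : ℝ), 0 < h →
      ∑ l ∈ S, critProfile σ (2 ^ l * h) ≤ C := by
  set b : ℝ := 2 ^ (1 - σ) with hb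
  set c : ℝ := 2 ^ (-σ) with hc
  have hb1 : 1 < b := one_lt_rpow (by norm_num) (by linarith)
  have hc0 : 0 < c := by positivity
  have hc1 : c < 1 := rpow_lt_one_of_one_lt_of_neg (by norm_num) (by linarith)
  have hb1' : 0 < b - 1 := by linarith
  have hc1' : 0 < 1 - c := by linarith
  have key : ∀ (τ : ℝ) (l : ℕ) (h : ℝ), 0 < h →
      ((2 : ℝ) ^ l * h) ^ τ = ((2 : ℝ) ^ τ) ^ l * h ^ τ := by
    intro τ l h hh
    rw [mul_rpow (by positivity) hh.le, ← rpow_natCast, ← rpow_natCast, ← rpow_mul (by norm_num),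
      ← rpow_mul (by norm_num), mul_comm (l : ℝ)]
  refine ⟨b / (b - 1) + 1 / (1 - c), by positivity, fun S h hh => ?_⟩
  rw [← Finset.sum_filter_add_sum_filter_not S fun l : ℕ => (2 : ℝ) ^ l * h ≤ 1]
  refine add_le_add ?_ ?_
  · refine (Finset.sum_le_sum fun l _ => min_le_right _ _).trans ?_
    simp_rw [key _ _ h hh]
    refine sum_pow_mul_le_of_one_lt hb1 (by positivity) _ fun l hl => ?_
    rw [hb, ← key _ _ h hh]
    exact rpow_le_one (by positivity) (Finset.mem_filter.1 hl).2 (by linarith)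
  · refine (Finset.sum_le_sum fun l _ => min_le_left _ _).trans ?_
    simp_rw [key _ _ h hh]
    refine sum_pow_mul_le_of_lt_one hc0.le hc1 _ (by positivity) fun l hl => ?_
    rw [hc, ← key _ _ h hh]
    exact rpow_le_one_of_one_le_of_nonpos (not_le.1 (Finset.mem_filter.1 hl).2).le (by linarith)

lemma integrable_critProfile {N : ℕ} (hN : 1 ≤ N) {σ : ℝ} (h0 : 0 < σ) (h1 : σ < 1) :
    Integrable (fun z : Euc N => critProfile σ ‖z‖ * ‖z‖ ^ (-(N : ℝ))) := by
  have : Nonempty (Fin N) := ⟨⟨0, hN⟩⟩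
  have hm : Measurable fun y : ℝ => y ^ (N - 1) • (critProfile σ y * y ^ (-(N : ℝ))) := by
    have := measurable_critProfile σ
    fun_prop
  have hy : ∀ y : ℝ, 0 < y → ∀ τ : ℝ,
      y ^ (N - 1) * (y ^ τ * y ^ (-(N : ℝ))) = y ^ (τ - 1) := by
    intro y hy τ
    rw [← rpow_natCast, ← rpow_add hy, ← rpow_add hy, Nat.cast_sub hN]
    congr 1
    push_cast
    ring
  refine (integrable_fun_norm_addHaar (E := Euc N) volume
    (f := fun y => critProfile σ y * y ^ (-(N : ℝ)))).2 ?_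
  rw [finrank_euclideanSpace_fin, ← Set.Ioc_union_Ioi_eq_Ioi (zero_le_one (α := ℝ))]
  refine IntegrableOn.union ?_ ?_
  · have hi : IntegrableOn (fun y : ℝ => y ^ (-σ)) (Set.Ioc 0 1) := by
      rw [← intervalIntegrable_iff_integrableOn_Ioc_of_le zero_le_one]
      exact intervalIntegral.intervalIntegrable_rpow' (by linarith)
    refine Integrable.mono' hi hm.aestronglyMeasurable ?_
    filter_upwards [ae_restrict_mem measurableSet_Ioc] with y hy'
    have hy0 : 0 < y := hy'.1
    have := critProfile_nonneg (σ := σ) hy0.le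
    rw [norm_of_nonneg (by simp only [smul_eq_mul]; positivity), smul_eq_mul]
    have h2 : y ^ (-σ) = y ^ ((1 - σ) - 1) := by congr 1; ring
    rw [h2, ← hy y hy0]
    gcongr
    exact min_le_right _ _
  · have hi : IntegrableOn (fun y : ℝ => y ^ (-σ - 1)) (Set.Ioi 1) :=
      integrableOn_Ioi_rpow_of_lt (by linarith) one_pos
    refine Integrable.mono' hi hm.aestronglyMeasurable ?_
    filter_upwards [ae_restrict_mem measurableSet_Ioi] with y hy'
    have hy0 : 0 < y := one_pos.trans hy'
    have := critProfile_nonneg (σ := σ) hy0.le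
    rw [norm_of_nonneg (by simp only [smul_eq_mul]; positivity), smul_eq_mul, ← hy y hy0]
    gcongr
    exact min_le_left _ _

lemma lintegral_critProfile_scaled {N : ℕ} (hN : 1 ≤ N) {σ : ℝ} (h0 : 0 < σ) (h1 : σ < 1) :
    ∃ κ : ℝ, 0 ≤ κ ∧ ∀ n : ℝ, 0 < n →
      ∫⁻ z : Euc N, ENNReal.ofReal (critProfile σ (n * ‖z‖) * ‖z‖ ^ (-(N : ℝ)))
        = ENNReal.ofReal κ := by
  have hint := integrable_critProfile hN h0 h1
  have hnn : ∀ z : Euc N, 0 ≤ critProfile σ ‖z‖ * ‖z‖ ^ (-(N : ℝ)) := fun z =>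
    mul_nonneg (critProfile_nonneg (norm_nonneg z)) (by positivity)
  refine ⟨∫ z : Euc N, critProfile σ ‖z‖ * ‖z‖ ^ (-(N : ℝ)),
    integral_nonneg hnn, fun n hn => ?_⟩
  have hscale : ∀ z : Euc N, critProfile σ (n * ‖z‖) * ‖z‖ ^ (-(N : ℝ)) =
      n ^ N * (critProfile σ ‖n • z‖ * ‖n • z‖ ^ (-(N : ℝ))) := by
    intro z
    rw [norm_smul, norm_of_nonneg hn.le, mul_rpow hn.le (norm_nonneg _), rpow_neg hn.le,
      rpow_natCast]
    field_simp
  simp_rw [hscale]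
  rw [← ofReal_integral_eq_lintegral_ofReal ((hint.comp_smul hn.ne').const_mul _)
    (Eventually.of_forall fun z => mul_nonneg (by positivity) (hnn _)), integral_const_mul,
    Measure.integral_comp_smul volume
      (fun z : Euc N => critProfile σ ‖z‖ * ‖z‖ ^ (-(N : ℝ))) n]
  rw [finrank_euclideanSpace_fin, abs_of_nonneg (by positivity), smul_eq_mul, ← mul_assoc,
    mul_inv_cancel₀ (by positivity), one_mul]

/-! ### Atoms and an upper bound for the Sobolev norm of a lacunary sum -/

/-- `f` is smooth and its `j`-th derivative is bounded by `K j * n ^ j`. -/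
def AtomBound {N : ℕ} {F : Type*} [NormedAddCommGroup F] [NormedSpace ℝ F]
    (K : ℕ → ℝ) (n : ℝ) (f : Euc N → F) : Prop :=
  ContDiff ℝ (⊤ : ℕ∞) f ∧ ∀ j x, ‖iteratedFDeriv ℝ j f x‖ ≤ K j * n ^ j

/-- The lacunary sum `∑ i, a 2^{-s e_i} v_i`. -/
def lacSum {N M : ℕ} {F : Type*} [NormedAddCommGroup F] [NormedSpace ℝ F]
    (s a : ℝ) (e : Fin M → ℕ) (v : Fin M → Euc N → F) (x : Euc N) : F :=
  ∑ i, (a * ((2 : ℝ) ^ e i) ^ (-s)) • v i x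

section Norm

variable {N M : ℕ} {F : Type*} [NormedAddCommGroup F] [NormedSpace ℝ F]

lemma AtomBound.contDiff {K : ℕ → ℝ} {n : ℝ} {f : Euc N → F} (h : AtomBound K n f) (j : ℕ) :
    ContDiff ℝ j f :=
  h.1.of_le (by exact_mod_cast le_top)

lemma iteratedFDeriv_lacSum {s a : ℝ} {e : Fin M → ℕ} {v : Fin M → Euc N → F} (j : ℕ)
    (hv : ∀ i, ContDiff ℝ j (v i)) (x : Euc N) :
    iteratedFDeriv ℝ j (lacSum s a e v) x =
      ∑ i, (a * ((2 : ℝ) ^ e i) ^ (-s)) • iteratedFDeriv ℝ j (v i) x := by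
  unfold lacSum
  rw [iteratedFDeriv_sum fun i _ => (hv i).const_smul _, Finset.sum_apply]
  exact Finset.sum_congr rfl fun i _ => iteratedFDeriv_const_smul_apply' (hv i).contDiffAt

lemma contDiff_lacSum {s a : ℝ} {e : Fin M → ℕ} {v : Fin M → Euc N → F} {j : WithTop ℕ∞}
    (hv : ∀ i, ContDiff ℝ j (v i)) : ContDiff ℝ j (lacSum s a e v) :=
  ContDiff.sum fun i _ => (hv i).const_smul _

lemma rpow_neg_mul_pow_floor {s : ℝ} {n : ℝ} (hn : 0 < n) :
    n ^ (-s) * n ^ ⌊s⌋₊ = n ^ (-(s - ⌊s⌋₊)) := by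
  rw [← rpow_natCast, ← rpow_add hn]
  congr 1
  ring

lemma sum_lacunary_le {s : ℝ} (hs : 0 < s) : ∃ C : ℝ, 0 < C ∧ ∀ (M : ℕ) (e : Fin M → ℕ),
    e.Injective → ((∃ k : ℕ, s = k) → M = 1) →
      ∑ i, ((2 : ℝ) ^ e i) ^ (-(s - ⌊s⌋₊)) ≤ C := by
  by_cases hk : ∃ k : ℕ, s = k
  · refine ⟨1, one_pos, fun M e _ hM => ?_⟩
    obtain rfl := hM hk
    obtain ⟨k, rfl⟩ := hk
    simp
  · have hσ : 0 < s - ⌊s⌋₊ := by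
      refine sub_pos.2 (lt_of_le_of_ne (Nat.floor_le hs.le) fun h => hk ⟨_, h.symm⟩)
    set c : ℝ := 2 ^ (-(s - ⌊s⌋₊)) with hc
    have hc0 : 0 < c := by positivity
    have hc1 : c < 1 := rpow_lt_one_of_one_lt_of_neg (by norm_num) (by linarith)
    have hc1' : 0 < 1 - c := by linarith
    refine ⟨1 / (1 - c), by positivity, fun M e he _ => ?_⟩
    have : ∀ l : ℕ, ((2 : ℝ) ^ l) ^ (-(s - ⌊s⌋₊)) = c ^ l * 1 := by
      intro l
      rw [hc, ← rpow_natCast, ← rpow_natCast, ← rpow_mul (by norm_num), ← rpow_mul (by norm_num),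
        mul_comm, mul_one]
    simp_rw [this]
    rw [← Finset.sum_image (s := Finset.univ) (f := fun l => c ^ l * 1) he.injOn]
    exact sum_pow_mul_le_of_lt_one hc0.le hc1 _ zero_le_one fun l _ => by
      simpa using pow_le_one₀ hc0.le hc1.le

lemma norm_iteratedFDeriv_lacSum_le {s : ℝ} (hs : 0 < s) {K : ℕ → ℝ} (hK : ∀ j, 0 ≤ K j) :
    ∃ C : ℝ, 0 < C ∧ ∀ (M : ℕ) (e : Fin M → ℕ) (v : Fin M → Euc N → F) (a : ℝ),
      e.Injective → ((∃ k : ℕ, s = k) → M = 1) → 0 ≤ a →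
      (∀ i, AtomBound K (2 ^ e i) (v i)) → ∀ j ≤ ⌊s⌋₊, ∀ x,
        ‖iteratedFDeriv ℝ j (lacSum s a e v) x‖ ≤ C * a := by
  obtain ⟨C, hC, hsum⟩ := sum_lacunary_le hs
  refine ⟨C * (1 + ∑ j ∈ Finset.range (⌊s⌋₊ + 1), K j), ?_, fun M e v a he hM ha hv j hj x => ?_⟩
  · have : 0 ≤ ∑ j ∈ Finset.range (⌊s⌋₊ + 1), K j := Finset.sum_nonneg fun _ _ => hK _
    positivity
  set K0 := 1 + ∑ j ∈ Finset.range (⌊s⌋₊ + 1), K j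
  have hKj : K j ≤ K0 := by
    have := Finset.single_le_sum (f := K) (fun i _ => hK i)
      (Finset.mem_range.2 (Nat.lt_succ_of_le hj))
    simp only [K0]
    linarith
  have hK0 : 0 ≤ K0 := (hK j).trans hKj
  rw [iteratedFDeriv_lacSum j fun i => (hv i).contDiff j]
  refine (norm_sum_le _ _).trans ?_
  calc ∑ i, ‖(a * ((2 : ℝ) ^ e i) ^ (-s)) • iteratedFDeriv ℝ j (v i) x‖
      ≤ ∑ i, a * K0 * ((2 : ℝ) ^ e i) ^ (-(s - ⌊s⌋₊)) := by
        refine Finset.sum_le_sum fun i _ => ?_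
        have h1 : (1 : ℝ) ≤ 2 ^ e i := one_le_pow₀ (by norm_num)
        rw [norm_smul, norm_of_nonneg (by positivity), ← rpow_neg_mul_pow_floor (by positivity)]
        calc a * ((2 : ℝ) ^ e i) ^ (-s) * ‖iteratedFDeriv ℝ j (v i) x‖
            ≤ a * ((2 : ℝ) ^ e i) ^ (-s) * (K0 * (2 ^ e i) ^ ⌊s⌋₊) := by
              gcongr
              refine ((hv i).2 j x).trans ?_
              gcongr
          _ = _ := by ring
    _ = a * K0 * ∑ i, ((2 : ℝ) ^ e i) ^ (-(s - ⌊s⌋₊)) := by rw [Finset.mul_sum]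
    _ ≤ a * K0 * C := by gcongr; exact hsum M e he hM
    _ = _ := by ring

lemma iteratedFDeriv_lacSum_eq_zero {s a : ℝ} {e : Fin M → ℕ} {v : Fin M → Euc N → F} {E : Set (Euc N)}
    {K : ℕ → ℝ} (hv : ∀ i, AtomBound K (2 ^ e i) (v i))
    (hE : ∀ i j, ∀ x ∉ E, iteratedFDeriv ℝ j (v i) x = 0) (j : ℕ) {x : Euc N} (hx : x ∉ E) :
    iteratedFDeriv ℝ j (lacSum s a e v) x = 0 := by
  rw [iteratedFDeriv_lacSum j fun i => (hv i).contDiff j]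
  simp [hE _ j x hx]

lemma integral_rpow_le_of_support {Ω E : Set (Euc N)} (hΩ : Bornology.IsBounded Ω)
    (hE : MeasurableSet E) {G : Type*} [NormedAddCommGroup G] {g : Euc N → G} {B p : ℝ}
    (hp : 0 < p) (hB : 0 ≤ B) (hg : ∀ x, ‖g x‖ ≤ B) (hgE : ∀ x ∉ E, g x = 0) :
    (∫ x in Ω, ‖g x‖ ^ p) ^ (1 / p) ≤ B * (volume.real (E ∩ Ω)) ^ (1 / p) := by
  have hfin : volume Ω ≠ ⊤ := hΩ.measure_lt_top.ne
  have h1 : ∫ x in Ω, ‖g x‖ ^ p ≤ ∫ x in Ω, E.indicator (fun _ => B ^ p) x := by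
    refine integral_mono_of_nonneg (Eventually.of_forall fun x => by positivity) ?_ ?_
    · exact (integrable_indicator_iff hE).2
        (integrableOn_const (by
          rw [Measure.restrict_apply hE]
          exact (measure_mono Set.inter_subset_right |>.trans_lt hfin.lt_top).ne))
    · refine Eventually.of_forall fun x => ?_
      by_cases hx : x ∈ E
      · simp only [Set.indicator_of_mem hx]
        exact rpow_le_rpow (norm_nonneg _) (hg x) hp.le
      · simp [hx, hgE x hx, hp.ne']
  have h2 : ∫ x in Ω, E.indicator (fun _ => B ^ p) x = B ^ p * volume.real (E ∩ Ω) := by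
    rw [integral_indicator hE, setIntegral_const, measureReal_restrict_apply hE, smul_eq_mul,
      mul_comm]
  rw [h2] at h1
  calc (∫ x in Ω, ‖g x‖ ^ p) ^ (1 / p) ≤ (B ^ p * volume.real (E ∩ Ω)) ^ (1 / p) :=
        rpow_le_rpow (integral_nonneg fun x => by positivity) h1 (by positivity)
    _ = B * (volume.real (E ∩ Ω)) ^ (1 / p) := by
        rw [mul_rpow (by positivity) (by positivity), ← rpow_mul hB, mul_one_div_cancel hp.ne',
          rpow_one]

lemma AtomBound.norm_iteratedFDeriv_sub_le {K : ℕ → ℝ} {n K0 : ℝ} {v : Euc N → F} {j : ℕ}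
    (hn : 0 < n) (hv : AtomBound K n v) (h0 : K j ≤ K0) (h1 : K (j + 1) ≤ K0) (x y : Euc N) :
    ‖iteratedFDeriv ℝ j v x - iteratedFDeriv ℝ j v y‖ ≤
      2 * K0 * n ^ j * min 1 (n * ‖x - y‖) := by
  have hK0 : 0 ≤ K0 := by
    have h := (norm_nonneg _).trans (hv.2 j x)
    exact (nonneg_of_mul_nonneg_left h (by positivity)).trans h0
  rw [mul_min_of_nonneg _ _ (by positivity), mul_one]
  refine le_min ?_ ?_
  · calc _ ≤ ‖iteratedFDeriv ℝ j v x‖ + ‖iteratedFDeriv ℝ j v y‖ := norm_sub_le _ _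
      _ ≤ K0 * n ^ j + K0 * n ^ j := by
          gcongr
          · exact (hv.2 j x).trans (by gcongr)
          · exact (hv.2 j y).trans (by gcongr)
      _ = _ := by ring
  · have hd : Differentiable ℝ (iteratedFDeriv ℝ j v) :=
      hv.1.differentiable_iteratedFDeriv (by exact_mod_cast WithTop.coe_lt_top _)
    have h := Convex.norm_image_sub_le_of_norm_fderiv_le (𝕜 := ℝ) (f := iteratedFDeriv ℝ j v)
      (s := Set.univ) (C := K0 * n ^ (j + 1)) (fun z _ => hd z)
      (fun z _ => by
        rw [norm_fderiv_iteratedFDeriv]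
        exact (hv.2 (j + 1) z).trans (by gcongr)) convex_univ (Set.mem_univ y) (Set.mem_univ x)
    refine h.trans ?_
    have : 0 ≤ K0 * n ^ (j + 1) * ‖x - y‖ := by positivity
    calc K0 * n ^ (j + 1) * ‖x - y‖ ≤ 2 * (K0 * n ^ (j + 1) * ‖x - y‖) := by linarith
      _ = _ := by ring

lemma gagliardo_quotient_le {s p : ℝ} (hs : 0 < s) (hns : ¬∃ k : ℕ, s = k) (hp : 1 < p)
    {K : ℕ → ℝ} (hK : ∀ j, 0 ≤ K j) :
    ∃ C : ℝ, 0 < C ∧ ∀ (M : ℕ) (e : Fin M → ℕ) (v : Fin M → Euc N → F) (a : ℝ) (E : Set (Euc N)),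
      e.Injective → 0 ≤ a → (∀ i, AtomBound K (2 ^ e i) (v i)) →
      (∀ i j, ∀ x ∉ E, iteratedFDeriv ℝ j (v i) x = 0) → ∀ x y,
        ‖iteratedFDeriv ℝ ⌊s⌋₊ (lacSum s a e v) x - iteratedFDeriv ℝ ⌊s⌋₊ (lacSum s a e v) y‖ ^ p /
            ‖x - y‖ ^ ((N : ℝ) + (s - ⌊s⌋₊) * p) ≤
          C * a ^ p * ∑ i, critProfile (s - ⌊s⌋₊) (2 ^ e i * ‖x - y‖) * ‖x - y‖ ^ (-(N : ℝ)) *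
            (E.indicator 1 x + E.indicator 1 y) := by
  have hσ0 : 0 < s - ⌊s⌋₊ :=
    sub_pos.2 (lt_of_le_of_ne (Nat.floor_le hs.le) fun h => hns ⟨_, h.symm⟩)
  have hσ1 : s - ⌊s⌋₊ < 1 := by linarith [Nat.lt_floor_add_one s]
  set σ := s - ⌊s⌋₊ with hσ
  obtain ⟨C, hC, hsum⟩ := sum_critProfile_le hσ0 hσ1
  set K0 := 1 + K ⌊s⌋₊ + K (⌊s⌋₊ + 1) with hK0
  have hk0 := hK ⌊s⌋₊
  have hk1 := hK (⌊s⌋₊ + 1)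
  have hK0p : 0 < K0 := by positivity
  refine ⟨(2 * K0) ^ p * C ^ (p - 1), by positivity, fun M e v a E he ha hv hE x y => ?_⟩
  have hind : ∀ z, 0 ≤ E.indicator (1 : Euc N → ℝ) z := fun z =>
    Set.indicator_nonneg (fun _ _ => zero_le_one) z
  have hphi : ∀ i, 0 ≤ critProfile σ (2 ^ e i * ‖x - y‖) := fun i =>
    critProfile_nonneg (by positivity)
  have hrhs : 0 ≤ (2 * K0) ^ p * C ^ (p - 1) * a ^ p *
      ∑ i, critProfile σ (2 ^ e i * ‖x - y‖) * ‖x - y‖ ^ (-(N : ℝ)) *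
            (E.indicator 1 x + E.indicator 1 y) := by
    refine mul_nonneg (by positivity) (Finset.sum_nonneg fun i _ => mul_nonneg
      (mul_nonneg (hphi i) (by positivity)) (add_nonneg (hind x) (hind y)))
  have hp0 : p ≠ 0 := by linarith
  rcases eq_or_ne x y with rfl | hxy
  · rw [sub_self, norm_zero, zero_rpow hp0, zero_div]
    exact hrhs
  by_cases hmem : x ∈ E ∨ y ∈ E
  swap
  · push Not at hmem
    rw [iteratedFDeriv_lacSum_eq_zero hv hE _ hmem.1, iteratedFDeriv_lacSum_eq_zero hv hE _ hmem.2,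
      sub_self, norm_zero, zero_rpow hp0, zero_div]
    exact hrhs
  have hone : 1 ≤ E.indicator (1 : Euc N → ℝ) x + E.indicator 1 y := by
    rcases hmem with h | h
    · have := hind y
      rw [Set.indicator_of_mem h, Pi.one_apply]
      linarith
    · have := hind x
      rw [Set.indicator_of_mem h, Pi.one_apply]
      linarith
  set h := ‖x - y‖ with hh
  have hh0 : 0 < h := norm_pos_iff.2 (sub_ne_zero.2 hxy)
  set Φ := ∑ i, critProfile σ (2 ^ e i * h) with hΦ
  have hΦ0 : 0 ≤ Φ := Finset.sum_nonneg fun i _ => hphi i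
  have hΦC : Φ ≤ C := by
    rw [hΦ, ← Finset.sum_image (s := Finset.univ) (f := fun l => critProfile σ (2 ^ l * h))
      he.injOn]
    exact hsum _ h hh0
  have hdiff : ‖iteratedFDeriv ℝ ⌊s⌋₊ (lacSum s a e v) x -
      iteratedFDeriv ℝ ⌊s⌋₊ (lacSum s a e v) y‖ ≤ 2 * K0 * a * h ^ σ * Φ := by
    rw [iteratedFDeriv_lacSum _ fun i => (hv i).contDiff _,
      iteratedFDeriv_lacSum _ fun i => (hv i).contDiff _, ← Finset.sum_sub_distrib, hΦ,
      Finset.mul_sum]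
    refine (norm_sum_le _ _).trans (Finset.sum_le_sum fun i _ => ?_)
    have hn : (0 : ℝ) < 2 ^ e i := by positivity
    rw [← smul_sub, norm_smul, norm_of_nonneg (by positivity), critProfile_eq (by positivity),
      mul_rpow hn.le hh0.le, ← rpow_neg_mul_pow_floor hn]
    calc a * ((2 : ℝ) ^ e i) ^ (-s) * _
        ≤ a * ((2 : ℝ) ^ e i) ^ (-s) *
            (2 * K0 * (2 ^ e i) ^ ⌊s⌋₊ * min 1 (2 ^ e i * h)) := by
          gcongr
          exact (hv i).norm_iteratedFDeriv_sub_le hn (by linarith) (by linarith) x y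
      _ = a * ((2 : ℝ) ^ e i) ^ (-s) *
            (2 * K0 * (2 ^ e i) ^ ⌊s⌋₊ * min 1 (2 ^ e i * h)) * (h ^ σ * h ^ (-σ)) := by
          rw [← rpow_add hh0, add_neg_cancel, rpow_zero, mul_one]
      _ = _ := by ring
  have hΦp : Φ ^ p ≤ C ^ (p - 1) * Φ := by
    rcases hΦ0.eq_or_lt with h0 | h0
    · rw [← h0, zero_rpow hp0, mul_zero]
    · calc Φ ^ p = Φ ^ (p - 1) * Φ := by
            rw [← rpow_add_one h0.ne', sub_add_cancel]
        _ ≤ _ := by gcongr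
  calc _ ≤ (2 * K0 * a * h ^ σ * Φ) ^ p / h ^ ((N : ℝ) + σ * p) := by gcongr
    _ = (2 * K0) ^ p * a ^ p * Φ ^ p * h ^ (-(N : ℝ)) := by
        rw [mul_rpow (by positivity) hΦ0, mul_rpow (by positivity) (by positivity),
          mul_rpow (by positivity) ha, ← rpow_mul hh0.le, div_eq_mul_inv, ← rpow_neg hh0.le,
          neg_add, rpow_add hh0]
        have : h ^ (σ * p) * h ^ (-(σ * p)) = 1 := by
          rw [← rpow_add hh0, add_neg_cancel, rpow_zero]
        linear_combination (2 * K0) ^ p * a ^ p * Φ ^ p * h ^ (-(N : ℝ)) * this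
    _ ≤ (2 * K0) ^ p * a ^ p * (C ^ (p - 1) * Φ) * h ^ (-(N : ℝ)) := by gcongr
    _ = (2 * K0) ^ p * C ^ (p - 1) * a ^ p * (Φ * h ^ (-(N : ℝ))) * 1 := by ring
    _ ≤ (2 * K0) ^ p * C ^ (p - 1) * a ^ p * (Φ * h ^ (-(N : ℝ))) *
          (E.indicator 1 x + E.indicator 1 y) := by gcongr
    _ = _ := by
        rw [hΦ, ← Finset.sum_mul, ← Finset.sum_mul]
        ring

lemma lintegral_gagliardo_kernel_le (hN : 1 ≤ N) {σ : ℝ} (h0 : 0 < σ) (h1 : σ < 1) :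
    ∃ κ : ℝ, 0 ≤ κ ∧ ∀ (Ω E : Set (Euc N)), MeasurableSet Ω → MeasurableSet E → ∀ n : ℝ, 0 < n →
      ∫⁻ x in Ω, ∫⁻ y in Ω, ENNReal.ofReal (critProfile σ (n * ‖x - y‖) * ‖x - y‖ ^ (-(N : ℝ)) *
          (E.indicator 1 x + E.indicator 1 y)) ≤ ENNReal.ofReal κ * volume (E ∩ Ω) := by
  obtain ⟨κ, hκ, hint⟩ := lintegral_critProfile_scaled hN h0 h1
  refine ⟨2 * κ, by positivity, fun Ω E hΩ hE n hn => ?_⟩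
  set k : Euc N → ENNReal := fun z =>
    ENNReal.ofReal (critProfile σ (n * ‖z‖) * ‖z‖ ^ (-(N : ℝ))) with hk
  have hkm : Measurable k := by
    have := measurable_critProfile σ
    fun_prop
  set χ : Euc N → ENNReal := E.indicator 1 with hχ
  have hχm : Measurable χ := measurable_one.indicator hE
  have hsplit : ∀ x y : Euc N, ENNReal.ofReal (critProfile σ (n * ‖x - y‖) *
      ‖x - y‖ ^ (-(N : ℝ)) * (E.indicator 1 x + E.indicator 1 y)) =
        χ x * k (x - y) + χ y * k (x - y) := by
    intro x y
    have hnn : 0 ≤ critProfile σ (n * ‖x - y‖) * ‖x - y‖ ^ (-(N : ℝ)) :=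
      mul_nonneg (critProfile_nonneg (by positivity)) (by positivity)
    have hind : ∀ z, 0 ≤ E.indicator (1 : Euc N → ℝ) z := fun z =>
      Set.indicator_nonneg (fun _ _ => zero_le_one) z
    rw [ENNReal.ofReal_mul hnn, ← add_mul, mul_comm, ENNReal.ofReal_add (hind x) (hind y)]
    have : ∀ z, ENNReal.ofReal (E.indicator 1 z) = χ z := by
      intro z
      by_cases hz : z ∈ E <;> simp [hχ, hz]
    rw [this, this]
  simp_rw [hsplit]
  have hleft : ∀ x : Euc N, ∫⁻ y in Ω, k (x - y) ≤ ENNReal.ofReal κ := fun x => by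
    refine (setLIntegral_le_lintegral _ _).trans ?_
    rw [lintegral_sub_left_eq_self k x]
    exact (hint n hn).le
  have hright : ∀ y : Euc N, ∫⁻ x in Ω, k (x - y) ≤ ENNReal.ofReal κ := fun y => by
    refine (setLIntegral_le_lintegral _ _).trans ?_
    rw [lintegral_sub_right_eq_self k y]
    exact (hint n hn).le
  have hχint : ∫⁻ x in Ω, χ x = volume (E ∩ Ω) := by
    rw [hχ, lintegral_indicator_one hE, Measure.restrict_apply hE]
  have hterm1 : ∫⁻ x in Ω, ∫⁻ y in Ω, χ x * k (x - y) ≤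
      ENNReal.ofReal κ * volume (E ∩ Ω) := by
    calc _ = ∫⁻ x in Ω, χ x * ∫⁻ y in Ω, k (x - y) :=
          lintegral_congr fun x => lintegral_const_mul _ (by fun_prop)
      _ ≤ ∫⁻ x in Ω, χ x * ENNReal.ofReal κ := lintegral_mono fun x => by gcongr; exact hleft x
      _ = _ := by rw [lintegral_mul_const _ hχm, hχint, mul_comm]
  have hterm2 : ∫⁻ x in Ω, ∫⁻ y in Ω, χ y * k (x - y) ≤
      ENNReal.ofReal κ * volume (E ∩ Ω) := by
    rw [lintegral_lintegral_swap (by fun_prop)]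
    calc _ = ∫⁻ y in Ω, χ y * ∫⁻ x in Ω, k (x - y) :=
          lintegral_congr fun x => lintegral_const_mul _ (by fun_prop)
      _ ≤ ∫⁻ y in Ω, χ y * ENNReal.ofReal κ := lintegral_mono fun y => by gcongr; exact hright y
      _ = _ := by rw [lintegral_mul_const _ hχm, hχint, mul_comm]
  calc ∫⁻ x in Ω, ∫⁻ y in Ω, (χ x * k (x - y) + χ y * k (x - y))
      = (∫⁻ x in Ω, ∫⁻ y in Ω, χ x * k (x - y)) + ∫⁻ x in Ω, ∫⁻ y in Ω, χ y * k (x - y) := by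
        rw [← lintegral_add_left]
        · exact lintegral_congr fun x => lintegral_add_left (by fun_prop) _
        · exact Measurable.lintegral_prod_right' (f := fun q : Euc N × Euc N => χ q.1 * k (q.1 - q.2))
            (by fun_prop)
    _ ≤ ENNReal.ofReal κ * volume (E ∩ Ω) + ENNReal.ofReal κ * volume (E ∩ Ω) :=
        add_le_add hterm1 hterm2
    _ = ENNReal.ofReal (2 * κ) * volume (E ∩ Ω) := by
        rw [← two_mul, ← mul_assoc, ENNReal.ofReal_mul (by norm_num), ENNReal.ofReal_ofNat]

lemma lintegral_lintegral_const_mul_sum {ι X : Type*} [Fintype ι] [MeasurableSpace X]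
    {μ : Measure X} [SFinite μ] {k : ι → X → X → ENNReal} (c : ENNReal)
    (hk : ∀ i, Measurable (Function.uncurry (k i))) :
    ∫⁻ x, ∫⁻ y, c * ∑ i, k i x y ∂μ ∂μ = c * ∑ i, ∫⁻ x, ∫⁻ y, k i x y ∂μ ∂μ := by
  have h1 : ∀ x, ∫⁻ y, c * ∑ i, k i x y ∂μ = c * ∑ i, ∫⁻ y, k i x y ∂μ := by
    intro x
    have hx : ∀ i, Measurable fun y => k i x y := fun i => (hk i).comp measurable_prodMk_left
    rw [lintegral_const_mul _ (by fun_prop), lintegral_finsetSum _ fun i _ => hx i]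
  have h2 : ∀ i, Measurable fun x => ∫⁻ y, k i x y ∂μ := fun i => (hk i).lintegral_prod_right'
  simp_rw [h1]
  rw [lintegral_const_mul _ (by fun_prop), lintegral_finsetSum _ fun i _ => h2 i]

lemma gagliardo_lacSum_le (hN : 1 ≤ N) {s p : ℝ} (hs : 0 < s) (hns : ¬∃ k : ℕ, s = k) (hp : 1 < p)
    {K : ℕ → ℝ} (hK : ∀ j, 0 ≤ K j) :
    ∃ C : ℝ, 0 < C ∧ ∀ (Ω E : Set (Euc N)), MeasurableSet Ω → Bornology.IsBounded Ω →
      MeasurableSet E → ∀ (M : ℕ) (e : Fin M → ℕ) (v : Fin M → Euc N → F) (a : ℝ),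
      e.Injective → 0 ≤ a → (∀ i, AtomBound K (2 ^ e i) (v i)) →
      (∀ i j, ∀ x ∉ E, iteratedFDeriv ℝ j (v i) x = 0) →
        (∫ x in Ω, ∫ y in Ω,
          ‖iteratedFDeriv ℝ ⌊s⌋₊ (lacSum s a e v) x - iteratedFDeriv ℝ ⌊s⌋₊ (lacSum s a e v) y‖ ^ p /
            ‖x - y‖ ^ ((N : ℝ) + (s - ⌊s⌋₊) * p)) ^ (1 / p) ≤
          C * a * (M * volume.real (E ∩ Ω)) ^ (1 / p) := by
  have hσ0 : 0 < s - ⌊s⌋₊ :=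
    sub_pos.2 (lt_of_le_of_ne (Nat.floor_le hs.le) fun h => hns ⟨_, h.symm⟩)
  have hσ1 : s - ⌊s⌋₊ < 1 := by linarith [Nat.lt_floor_add_one s]
  obtain ⟨C, hC, hquot⟩ := gagliardo_quotient_le (N := N) (F := F) hs hns hp hK
  obtain ⟨κ, hκ, hker⟩ := lintegral_gagliardo_kernel_le hN hσ0 hσ1
  set σ := s - ⌊s⌋₊ with hσ
  refine ⟨(C * (κ + 1)) ^ (1 / p), by positivity, fun Ω E hΩ hΩb hE M e v a he ha hv hvE => ?_⟩
  set G : Euc N → Euc N → ℝ := fun x y =>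
    ‖iteratedFDeriv ℝ ⌊s⌋₊ (lacSum s a e v) x - iteratedFDeriv ℝ ⌊s⌋₊ (lacSum s a e v) y‖ ^ p /
            ‖x - y‖ ^ ((N : ℝ) + σ * p) with hG
  have hG0 : ∀ x y, 0 ≤ G x y := fun x y => by positivity
  set k : Fin M → Euc N → Euc N → ℝ := fun i x y =>
    critProfile σ (2 ^ e i * ‖x - y‖) * ‖x - y‖ ^ (-(N : ℝ)) *
            (E.indicator 1 x + E.indicator 1 y) with hk
  have hk0 : ∀ i x y, 0 ≤ k i x y := fun i x y => mul_nonneg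
    (mul_nonneg (critProfile_nonneg (by positivity)) (by positivity))
    (add_nonneg (Set.indicator_nonneg (fun _ _ => zero_le_one) x)
      (Set.indicator_nonneg (fun _ _ => zero_le_one) y))
  have hkm : ∀ i, Measurable (fun q : Euc N × Euc N => ENNReal.ofReal (k i q.1 q.2)) := by
    intro i
    have := measurable_critProfile σ
    have hm : Measurable (E.indicator (1 : Euc N → ℝ)) := measurable_one.indicator hE
    fun_prop
  have hfin : volume (E ∩ Ω) ≠ ⊤ :=
    ((measure_mono Set.inter_subset_right).trans_lt hΩb.measure_lt_top).ne
  have hbound : ∫⁻ x in Ω, ∫⁻ y in Ω, ‖G x y‖ₑ ≤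
      ENNReal.ofReal (C * κ * a ^ p * (M * volume.real (E ∩ Ω))) := by
    calc ∫⁻ x in Ω, ∫⁻ y in Ω, ‖G x y‖ₑ
        ≤ ∫⁻ x in Ω, ∫⁻ y in Ω, ENNReal.ofReal (C * a ^ p) * ∑ i, ENNReal.ofReal (k i x y) := by
          refine lintegral_mono fun x => lintegral_mono fun y => ?_
          simp only
          rw [Real.enorm_of_nonneg (hG0 x y), ← ENNReal.ofReal_sum_of_nonneg fun i _ => hk0 i x y,
            ← ENNReal.ofReal_mul (by positivity)]
          exact ENNReal.ofReal_le_ofReal (hquot M e v a E he ha hv hvE x y)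
      _ = ENNReal.ofReal (C * a ^ p) *
            ∑ i, ∫⁻ x in Ω, ∫⁻ y in Ω, ENNReal.ofReal (k i x y) := lintegral_lintegral_const_mul_sum (k := fun i x y => ENNReal.ofReal (k i x y)) _ hkm
      _ ≤ ENNReal.ofReal (C * a ^ p) * ∑ _i : Fin M, ENNReal.ofReal κ * volume (E ∩ Ω) := by
          gcongr with i
          exact hker Ω E hΩ hE _ (by positivity)
      _ = _ := by
          rw [Finset.sum_const, Finset.card_univ, Fintype.card_fin, nsmul_eq_mul,
            ← ENNReal.ofReal_toReal hfin, ← ENNReal.ofReal_mul hκ, ← ENNReal.ofReal_natCast,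
            ← ENNReal.ofReal_mul (by positivity), ← ENNReal.ofReal_mul (by positivity)]
          congr 1
          simp only [Measure.real]
          ring
  have hreal : ∫ x in Ω, ∫ y in Ω, G x y ≤ C * κ * a ^ p * (M * volume.real (E ∩ Ω)) := by
    have h0 : 0 ≤ ∫ x in Ω, ∫ y in Ω, G x y :=
      integral_nonneg fun x => integral_nonneg fun y => hG0 x y
    rw [← ENNReal.ofReal_le_ofReal_iff (by positivity), ← Real.enorm_of_nonneg h0]
    refine (enorm_integral_le_lintegral_enorm _).trans
      ((lintegral_mono fun x => enorm_integral_le_lintegral_enorm _).trans hbound)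
  have h0 : 0 ≤ ∫ x in Ω, ∫ y in Ω, G x y :=
      integral_nonneg fun x => integral_nonneg fun y => hG0 x y
  have hp0 : 0 < p := by linarith
  calc (∫ x in Ω, ∫ y in Ω, G x y) ^ (1 / p)
      ≤ (C * (κ + 1) * a ^ p * (M * volume.real (E ∩ Ω))) ^ (1 / p) := by
        refine rpow_le_rpow h0 (hreal.trans ?_) (by positivity)
        gcongr
        linarith
    _ = _ := by
        rw [mul_rpow (by positivity) (by positivity), mul_rpow (by positivity) (by positivity),
          ← rpow_mul ha, mul_one_div_cancel hp0.ne', rpow_one]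

theorem sobNorm_lacSum_le (hN : 1 ≤ N) {s p : ℝ} (hs : 0 < s) (hp : 1 < p)
    {K : ℕ → ℝ} (hK : ∀ j, 0 ≤ K j) :
    ∃ C : ℝ, 0 < C ∧ ∀ (Ω E : Set (Euc N)), MeasurableSet Ω → Bornology.IsBounded Ω →
      MeasurableSet E → ∀ (M : ℕ) (e : Fin M → ℕ) (v : Fin M → Euc N → F) (a : ℝ), 1 ≤ M →
      e.Injective → ((∃ k : ℕ, s = k) → M = 1) → 0 ≤ a → (∀ i, AtomBound K (2 ^ e i) (v i)) →
      (∀ i j, ∀ x ∉ E, iteratedFDeriv ℝ j (v i) x = 0) →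
        sobNorm Ω s p (lacSum s a e v) ≤ C * a * (M * volume.real (E ∩ Ω)) ^ (1 / p) := by
  have hp0 : 0 < p := by linarith
  obtain ⟨C, hC, hsup⟩ := norm_iteratedFDeriv_lacSum_le (N := N) (F := F) hs hK
  have hint : ∀ (Ω E : Set (Euc N)), Bornology.IsBounded Ω →
      MeasurableSet E → ∀ (M : ℕ) (e : Fin M → ℕ) (v : Fin M → Euc N → F) (a : ℝ), 1 ≤ M →
      e.Injective → ((∃ k : ℕ, s = k) → M = 1) → 0 ≤ a → (∀ i, AtomBound K (2 ^ e i) (v i)) →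
      (∀ i j, ∀ x ∉ E, iteratedFDeriv ℝ j (v i) x = 0) →
        intSobNorm Ω ⌊s⌋₊ p (lacSum s a e v) ≤
          (⌊s⌋₊ + 1) * C * a * (M * volume.real (E ∩ Ω)) ^ (1 / p) := by
    intro Ω E hΩ hE M e v a hM he hsM ha hv hvE
    have hM' : (1 : ℝ) ≤ M := by exact_mod_cast hM
    calc intSobNorm Ω ⌊s⌋₊ p (lacSum s a e v)
        ≤ ∑ j ∈ Finset.range (⌊s⌋₊ + 1), C * a * (M * volume.real (E ∩ Ω)) ^ (1 / p) := by
          refine Finset.sum_le_sum fun j hj => ?_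
          refine (integral_rpow_le_of_support hΩ hE hp0 (by positivity)
            (hsup M e v a he hsM ha hv j (Nat.lt_succ_iff.1 (Finset.mem_range.1 hj)))
            fun x hx => iteratedFDeriv_lacSum_eq_zero hv hvE j hx).trans ?_
          gcongr
          exact le_mul_of_one_le_left (by positivity) hM'
      _ = _ := by
          rw [Finset.sum_const, Finset.card_range, nsmul_eq_mul]
          push_cast
          ring
  by_cases hns : ∃ k : ℕ, s = k
  · refine ⟨(⌊s⌋₊ + 1) * C, by positivity, fun Ω E _ hΩb hE M e v a hM he hsM ha hv hvE => ?_⟩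
    rw [sobNorm, if_pos hns]
    exact hint Ω E hΩb hE M e v a hM he hsM ha hv hvE
  · obtain ⟨C', hC', hgag⟩ := gagliardo_lacSum_le (N := N) (F := F) hN hs hns hp hK
    refine ⟨(⌊s⌋₊ + 1) * C + C', by positivity,
      fun Ω E hΩ hΩb hE M e v a hM he hsM ha hv hvE => ?_⟩
    rw [sobNorm, if_neg hns, add_mul, add_mul]
    exact add_le_add (hint Ω E hΩb hE M e v a hM he hsM ha hv hvE)
      (hgag Ω E hΩ hΩb hE M e v a he ha hv hvE)

end Norm

/-! ### Hyperdeterminants with a diagonal block and iterated partial derivatives -/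

lemma hyperDet_eq_prod_diag {m q : ℕ} (A : (Fin (m + 1) → Fin (q + 1)) → ℝ)
    (hA : ∀ (k : Fin q) (l : Fin m → Fin (q + 1)), (∃ s, l s ≠ k.castSucc) →
      A (Fin.cons k.castSucc l) = 0) :
    hyperDet A = ∏ k, A (Fin.cons k fun _ => k) := by
  rw [hyperDet, Finset.sum_eq_single (fun _ => 1)]
  · simp
  · intro τ _ hτ
    have h1 : ∃ s, τ s ≠ 1 := by
      by_contra! h
      exact hτ (funext h)
    obtain ⟨s, hs⟩ := h1
    have h2 : ∃ k : Fin q, τ s k.castSucc ≠ k.castSucc := by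
      by_contra! h
      refine hs (Equiv.ext fun k => ?_)
      refine Fin.lastCases ?_ (fun i => h i) k
      by_contra hne
      obtain ⟨i, hi⟩ := Fin.exists_castSucc_eq.2 hne
      have := (τ s).injective ((h i).trans hi)
      exact (Fin.castSucc_lt_last i).ne this
    obtain ⟨k, hk⟩ := h2
    rw [Finset.prod_eq_zero (Finset.mem_univ k.castSucc) (hA k _ ⟨s, hk⟩), mul_zero]
  · simp

lemma jacMinor_eq_prod {N n m q : ℕ} (hn : q + 1 ≤ n) (hN : q + 1 ≤ N)
    (u : Euc N → Fin n → ℝ) (x : Euc N)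
    (hu : ∀ (k : Fin q) (l : List (Fin N)), l.length = m →
      (∃ j ∈ l, j ≠ Fin.castLE hN k.castSucc) →
      pderivList l (fun y => u y (Fin.castLE hn k.castSucc)) x = 0) :
    jacMinor m (q + 1) (Fin.castLE hn) (fun _ => Fin.castLE hN) u x =
      ∏ k, pderivList (List.replicate m (Fin.castLE hN k)) (fun y => u y (Fin.castLE hn k)) x := by
  rw [jacMinor, hyperDet_eq_prod_diag]
  · refine Finset.prod_congr rfl fun k _ => ?_
    simp [List.ofFn_const]
  · rintro k l ⟨s, hs⟩
    simp only [Fin.cons_zero, Fin.cons_succ]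
    refine hu k _ (by simp) ⟨Fin.castLE hN (l s), ?_, fun h => hs (Fin.castLE_injective hN h)⟩
    rw [List.mem_ofFn]
    exact ⟨s, rfl⟩

section PartialDerivatives

variable {N : ℕ}

lemma pderivList_congr {f g : Euc N → ℝ} {x : Euc N} (h : f =ᶠ[𝓝 x] g) (l : List (Fin N)) :
    pderivList l f =ᶠ[𝓝 x] pderivList l g := by
  induction l with
  | nil => exact h
  | cons i l ih =>
    have := ih.fderiv (𝕜 := ℝ)
    filter_upwards [this] with y hy
    simp only [pderivList, pderiv', hy]

lemma pderivList_zero (l : List (Fin N)) : pderivList l (fun _ => 0) = fun _ => 0 := by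
  induction l with
  | nil => rfl
  | cons i l ih =>
    funext x
    simp [pderivList, pderiv', ih]

lemma hasFDerivAt_comp_coord {g : ℝ → ℝ} (i : Fin N) (x : Euc N)
    (hg : DifferentiableAt ℝ g (x i)) :
    HasFDerivAt (fun y : Euc N => g (y i))
      (deriv g (x i) • (EuclideanSpace.proj i : Euc N →L[ℝ] ℝ)) x :=
  hg.hasDerivAt.comp_hasFDerivAt x (EuclideanSpace.proj i : Euc N →L[ℝ] ℝ).hasFDerivAt

lemma pderivList_comp_coord {g : ℝ → ℝ} (hg : ContDiff ℝ (⊤ : ℕ∞) g) (i : Fin N)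
    (l : List (Fin N)) :
    pderivList l (fun y => g (y i)) =
      fun y => if ∀ j ∈ l, j = i then iteratedDeriv l.length g (y i) else 0 := by
  induction l with
  | nil => simp [pderivList]
  | cons j l ih =>
    funext x
    rw [pderivList, ih, pderiv']
    by_cases hl : ∀ j ∈ l, j = i
    · simp only [List.mem_cons, forall_eq_or_imp, List.length_cons, if_pos hl]
      rw [(hasFDerivAt_comp_coord i x ((hg.differentiable_iteratedDeriv l.length
        (by exact_mod_cast WithTop.coe_lt_top _)) _)).fderiv]
      by_cases hj : j = i
      · subst hj
        rw [if_pos ⟨rfl, hl⟩]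
        simp [iteratedDeriv_succ]
      · have : ¬ i = j := fun h => hj h.symm
        simp [hj, this]
    · simp [hl]

lemma pderivList_replicate_mul {g : ℝ → ℝ} (hg : ContDiff ℝ (⊤ : ℕ∞) g) {P : Euc N → ℝ}
    (hP : Differentiable ℝ P) (i : Fin N)
    (hPi : ∀ x (t : ℝ), P (x + t • EuclideanSpace.single i 1) = P x) (m : ℕ) :
    pderivList (List.replicate m i) (fun y => g (y i) * P y) =
      fun y => iteratedDeriv m g (y i) * P y := by
  induction m with
  | zero => simp [pderivList]
  | succ m ih =>
    funext x
    rw [List.replicate_succ, pderivList, ih, pderiv']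
    have h0 : fderiv ℝ P x (EuclideanSpace.single i 1) = 0 := by
      rw [← (hP x).lineDeriv_eq_fderiv, lineDeriv]
      simp [hPi]
    have h1 := (hasFDerivAt_comp_coord i x ((hg.differentiable_iteratedDeriv m
        (by exact_mod_cast WithTop.coe_lt_top _)) _)).mul (hP x).hasFDerivAt
    change fderiv ℝ ((fun y : Euc N => iteratedDeriv m g (y i)) * P) x _ = _
    rw [h1.fderiv]
    simp [h0, iteratedDeriv_succ, mul_comm]

lemma contDiff_pderiv' {f : Euc N → ℝ} (hf : ContDiff ℝ (⊤ : ℕ∞) f) (i : Fin N) :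
    ContDiff ℝ (⊤ : ℕ∞) (pderiv' i f) :=
  (hf.fderiv_right (m := ((⊤ : ℕ∞) : WithTop ℕ∞)) (by simp)).clm_apply contDiff_const

lemma contDiff_pderivList {f : Euc N → ℝ} (hf : ContDiff ℝ (⊤ : ℕ∞) f) (l : List (Fin N)) :
    ContDiff ℝ (⊤ : ℕ∞) (pderivList l f) := by
  induction l with
  | nil => exact hf
  | cons i l ih => exact contDiff_pderiv' ih i

lemma hasCompactSupport_pderivList {f : Euc N → ℝ} (hf : HasCompactSupport f)
    (l : List (Fin N)) : HasCompactSupport (pderivList l f) := by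
  induction l with
  | nil => exact hf
  | cons i l ih => exact ih.fderiv_apply ℝ _

lemma pderivList_append_singleton (l : List (Fin N)) (i : Fin N) (f : Euc N → ℝ) :
    pderivList (l ++ [i]) f = pderivList l (pderiv' i f) := by
  induction l with
  | nil => rfl
  | cons j l ih => simp only [List.cons_append, pderivList, ih]

lemma integral_pderiv'_mul {f g : Euc N → ℝ} (hf : ContDiff ℝ (⊤ : ℕ∞) f)
    (hfc : HasCompactSupport f) (hg : ContDiff ℝ (⊤ : ℕ∞) g) (i : Fin N) :
    ∫ x, pderiv' i f x * g x = -∫ x, f x * pderiv' i g x := by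
  have hf' := contDiff_pderiv' hf i
  have hg' := contDiff_pderiv' hg i
  have hfc' : HasCompactSupport (pderiv' i f) := hfc.fderiv_apply ℝ _
  have h := integral_mul_fderiv_eq_neg_fderiv_mul_of_integrable (μ := volume) (f := f) (g := g)
    (v := EuclideanSpace.single i 1)
    ((hf'.continuous.mul hg.continuous).integrable_of_hasCompactSupport hfc'.mul_right)
    ((hf.continuous.mul hg'.continuous).integrable_of_hasCompactSupport hfc.mul_right)
    ((hf.continuous.mul hg.continuous).integrable_of_hasCompactSupport hfc.mul_right)
    (fun x _ => hf.differentiable (by simp) x) (fun x _ => hg.differentiable (by simp) x)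
  simp only [pderiv']
  rw [h, neg_neg]

lemma integral_pderivList_replicate_mul {f g : Euc N → ℝ} (hf : ContDiff ℝ (⊤ : ℕ∞) f)
    (hfc : HasCompactSupport f) (hg : ContDiff ℝ (⊤ : ℕ∞) g) (i : Fin N) (m : ℕ) :
    ∫ x, pderivList (List.replicate m i) f x * g x =
      (-1) ^ m * ∫ x, f x * pderivList (List.replicate m i) g x := by
  induction m generalizing g with
  | zero => simp [pderivList]
  | succ m ih =>
    have h1 := integral_pderiv'_mul (contDiff_pderivList hf (List.replicate m i))
      (hasCompactSupport_pderivList hfc _) hg i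
    rw [List.replicate_succ, pderivList, h1, ih (contDiff_pderiv' hg i),
      ← pderivList_append_singleton, ← List.replicate_succ', List.replicate_succ]
    ring

lemma iteratedDeriv_sin_phase (n θ : ℝ) (m : ℕ) :
    iteratedDeriv m (fun t => sin (n * t + (θ - m * (π / 2)))) =
      fun t => n ^ m * sin (n * t + θ) := by
  induction m with
  | zero => simp
  | succ m ih =>
    have h : deriv (fun t => sin (n * t + (θ - ((m + 1 : ℕ) : ℝ) * (π / 2)))) =
        fun t => n * sin (n * t + (θ - m * (π / 2))) := by
      funext t
      have h1 : HasDerivAt (fun t : ℝ => n * t + (θ - ((m + 1 : ℕ) : ℝ) * (π / 2))) n t := by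
        simpa using ((hasDerivAt_id t).const_mul n).add_const (θ - ((m + 1 : ℕ) : ℝ) * (π / 2))
      rw [h1.sin.deriv, mul_comm, ← sin_add_pi_div_two]
      congr 2
      push_cast
      ring
    rw [iteratedDeriv_succ', h]
    funext t
    rw [iteratedDeriv_const_mul_field, ih]
    ring

lemma iteratedDeriv_pow_div_factorial (n : ℝ) (m : ℕ) :
    iteratedDeriv m (fun t : ℝ => (n * t) ^ m / m.factorial) = fun _ => n ^ m := by
  funext t
  have : (fun t : ℝ => (n * t) ^ m / m.factorial) = fun t => n ^ m / m.factorial * t ^ m := by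
    funext t
    rw [mul_pow]
    ring
  rw [this, iteratedDeriv_const_mul_field, iteratedDeriv_eq_iterate, iter_deriv_pow]
  have h : ∏ i ∈ Finset.range m, ((m : ℝ) - i) = m.factorial := by
    rw [← Nat.descFactorial_self, Nat.descFactorial_eq_prod_range, Nat.cast_prod]
    exact Finset.prod_congr rfl fun i hi => (Nat.cast_sub (Finset.mem_range.1 hi).le).symm
  rw [h, Nat.sub_self, pow_zero, mul_one, div_mul_cancel₀]
  positivity

end PartialDerivatives

/-! ### Construction of atoms -/

section Atoms

variable {N : ℕ}

lemma AtomBound.mono {F : Type*} [NormedAddCommGroup F] [NormedSpace ℝ F] {K K' : ℕ → ℝ} {n : ℝ}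
    {f : Euc N → F} (h : AtomBound K n f) (hn : 0 ≤ n) (hK : ∀ j, K j ≤ K' j) :
    AtomBound K' n f :=
  ⟨h.1, fun j x => (h.2 j x).trans (by gcongr; exact hK j)⟩

lemma AtomBound.mono_scale {F : Type*} [NormedAddCommGroup F] [NormedSpace ℝ F] {K : ℕ → ℝ}
    {f : Euc N → F} {n n' : ℝ} (h : AtomBound K n f) (hn : 0 ≤ n) (hnn : n ≤ n')
    (hK : ∀ j, 0 ≤ K j) : AtomBound K n' f :=
  ⟨h.1, fun j x => (h.2 j x).trans (by have := hK j; gcongr)⟩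

lemma AtomBound.comp_smul {F : Type*} [NormedAddCommGroup F] [NormedSpace ℝ F] {K : ℕ → ℝ}
    {f : Euc N → F} (h : AtomBound K 1 f) {n : ℝ} (hn : 0 ≤ n) :
    AtomBound K n fun x => f (n • x) := by
  refine ⟨h.1.comp (contDiff_const_smul n), fun j x => ?_⟩
  rw [iteratedFDeriv_comp_const_smul n (h.contDiff j), norm_smul, norm_pow,
    norm_of_nonneg hn, mul_comm]
  gcongr
  simpa using h.2 j (n • x)

lemma AtomBound.mul {K₁ K₂ : ℕ → ℝ} {n : ℝ} {f g : Euc N → ℝ} (hf : AtomBound K₁ n f)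
    (hg : AtomBound K₂ n g) :
    AtomBound (fun j => ∑ i ∈ Finset.range (j + 1), j.choose i * K₁ i * K₂ (j - i)) n
      fun x => f x * g x := by
  refine ⟨hf.1.mul hg.1, fun j x => ?_⟩
  refine (norm_iteratedFDeriv_mul_le (hf.contDiff j) (hg.contDiff j) x le_rfl).trans ?_
  rw [Finset.sum_mul]
  refine Finset.sum_le_sum fun i hi => ?_
  have hij : i + (j - i) = j := by have := Finset.mem_range.1 hi; omega
  calc _ ≤ (j.choose i : ℝ) * (K₁ i * n ^ i) * (K₂ (j - i) * n ^ (j - i)) := by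
        gcongr
        · exact mul_nonneg (by positivity) ((norm_nonneg _).trans (hf.2 i x))
        · exact hf.2 i x
        · exact hg.2 _ x
    _ = (j.choose i : ℝ) * K₁ i * K₂ (j - i) * (n ^ i * n ^ (j - i)) := by ring
    _ = _ := by rw [← pow_add, hij]

lemma exists_atomBound_prod {K : ℕ → ℝ} (hK : ∀ j, 0 ≤ K j) (q : ℕ) :
    ∃ K' : ℕ → ℝ, (∀ j, 0 ≤ K' j) ∧ ∀ (n : ℝ), 0 ≤ n → ∀ f : Fin q → Euc N → ℝ,
      (∀ i, AtomBound K n (f i)) → AtomBound K' n fun x => ∏ i, f i x := by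
  induction q with
  | zero =>
    refine ⟨fun _ => 1, fun _ => zero_le_one, fun n hn f _ => ⟨by simpa using contDiff_const,
      fun j x => ?_⟩⟩
    simp only [Finset.univ_eq_empty, Finset.prod_empty]
    cases j with
    | zero => simp
    | succ j =>
      rw [iteratedFDeriv_succ_const]
      simpa using by positivity
  | succ q ih =>
    obtain ⟨K', hK', h⟩ := ih
    refine ⟨fun j => ∑ i ∈ Finset.range (j + 1), j.choose i * K' i * K (j - i), fun j => ?_,
      fun n hn f hf => ?_⟩
    · exact Finset.sum_nonneg fun i _ => by
        have := hK' i
        have := hK (j - i)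
        positivity
    · simp_rw [Fin.prod_univ_castSucc]
      exact (h n hn _ fun i => hf i.castSucc).mul (hf _)

lemma contDiff_sin_affine (n θ : ℝ) {k : WithTop ℕ∞} : ContDiff ℝ k fun t => sin (n * t + θ) := by
  fun_prop

lemma atomBound_sin_coord (i : Fin N) {n : ℝ} (hn : 0 ≤ n) (θ : ℝ) :
    AtomBound (fun _ => 1) n fun x : Euc N => sin (n * x i + θ) := by
  have heq : (fun x : Euc N => sin (n * x i + θ)) =
      (fun t => sin (n * t + θ)) ∘ (EuclideanSpace.proj i : Euc N →L[ℝ] ℝ) := rfl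
  have hproj : ‖(EuclideanSpace.proj i : Euc N →L[ℝ] ℝ)‖ ≤ 1 :=
    ContinuousLinearMap.opNorm_le_bound _ zero_le_one fun x => by
      simpa using PiLp.norm_apply_le x i
  refine ⟨by rw [heq]; exact (contDiff_sin_affine n θ).comp (ContinuousLinearMap.contDiff _),
    fun j x => ?_⟩
  rw [heq, ContinuousLinearMap.iteratedFDeriv_comp_right _ (contDiff_sin_affine n θ) x le_rfl]
  refine (ContinuousMultilinearMap.norm_compContinuousLinearMap_le _ _).trans ?_
  have h1 := iteratedDeriv_sin_phase n (θ + j * (π / 2)) j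
  rw [add_sub_cancel_right] at h1
  rw [norm_iteratedFDeriv_eq_norm_iteratedDeriv, h1, one_mul]
  refine (mul_le_of_le_one_right (norm_nonneg _)
    (Finset.prod_le_one (fun _ _ => norm_nonneg _) fun _ _ => hproj)).trans ?_
  rw [norm_mul, norm_pow, norm_of_nonneg hn]
  exact mul_le_of_le_one_right (by positivity) (abs_sin_le_one _)

lemma exists_atomBound_of_hasCompactSupport {f : Euc N → ℝ} (hf : ContDiff ℝ (⊤ : ℕ∞) f)
    (hc : HasCompactSupport f) :
    ∃ K : ℕ → ℝ, (∀ j, 0 ≤ K j) ∧ AtomBound K 1 f := by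
  have h : ∀ j : ℕ, ∃ C, ∀ x, ‖iteratedFDeriv ℝ j f x‖ ≤ C := fun j =>
    (hf.continuous_iteratedFDeriv (by exact_mod_cast le_top)).bounded_above_of_compact_support
      (hc.iteratedFDeriv j)
  choose K hK using h
  exact ⟨K, fun j => (norm_nonneg _).trans (hK j 0), hf, fun j x => by simpa using hK j x⟩

/-- The map `Euc N → ℝⁿ` whose first `r` components are `w` and whose other ones vanish. -/
def padComponents {n r : ℕ} (hn : r ≤ n) (w : Fin r → Euc N → ℝ) (x : Euc N) : Fin n → ℝ :=
  ∑ k, w k x • Pi.single (Fin.castLE hn k) (1 : ℝ)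

lemma padComponents_castLE {n r : ℕ} (hn : r ≤ n) (w : Fin r → Euc N → ℝ) (x : Euc N)
    (k : Fin r) : padComponents hn w x (Fin.castLE hn k) = w k x := by
  simp [padComponents, Pi.single_apply, (Fin.castLE_injective hn).eq_iff]

lemma AtomBound.padComponents {n r : ℕ} (hn : r ≤ n) {K : ℕ → ℝ} {ν : ℝ}
    {w : Fin r → Euc N → ℝ} (hw : ∀ k, AtomBound K ν (w k)) :
    AtomBound (fun j => r * K j) ν (padComponents hn w) := by
  have hL : ∀ k, (fun x => w k x • (Pi.single (Fin.castLE hn k) (1 : ℝ) : Fin n → ℝ)) =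
      ((ContinuousLinearMap.id ℝ ℝ).smulRight (Pi.single (Fin.castLE hn k) (1 : ℝ) : Fin n → ℝ)) ∘
        w k := fun k => rfl
  refine ⟨ContDiff.sum fun k _ => (hw k).1.smul contDiff_const, fun j x => ?_⟩
  have hc : ∀ k, ContDiff ℝ j fun x => w k x • (Pi.single (Fin.castLE hn k) (1 : ℝ) : Fin n → ℝ) :=
    fun k => ((hw k).contDiff j).smul contDiff_const
  unfold _root_.padComponents
  rw [iteratedFDeriv_fun_sum_apply fun k _ => (hc k).contDiffAt]
  refine (norm_sum_le _ _).trans ?_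
  calc _ ≤ ∑ _k : Fin r, K j * ν ^ j := by
        refine Finset.sum_le_sum fun k _ => ?_
        rw [hL]
        refine (ContinuousLinearMap.norm_iteratedFDeriv_comp_left _
          ((hw k).contDiff j).contDiffAt le_rfl).trans ?_
        rw [ContinuousLinearMap.norm_smulRight_apply, Pi.norm_single]
        simpa using (hw k).2 j x
    _ = _ := by
        rw [Finset.sum_const, Finset.card_univ, Fintype.card_fin, nsmul_eq_mul, mul_assoc]

lemma iteratedFDeriv_eq_zero_of_notMem {F : Type*} [NormedAddCommGroup F] [NormedSpace ℝ F]
    {E : Set (Euc N)} (hE : IsClosed E) {f : Euc N → F} (hf : ∀ x ∉ E, f x = 0) (j : ℕ) {x : Euc N}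
    (hx : x ∉ E) : iteratedFDeriv ℝ j f x = 0 := by
  have hsub : tsupport f ⊆ E :=
    closure_minimal (fun y hy => by_contra fun h => hy (hf y h)) hE
  by_contra h
  exact hx (hsub (support_iteratedFDeriv_subset j h))

/-- A smooth cutoff of the monomial `x_i ^ m / m!`. -/
def cutMonomial (φ : ContDiffBump (0 : Euc N)) (m : ℕ) (i : Fin N) (x : Euc N) : ℝ :=
  φ x * (x i ^ m / m.factorial)

lemma contDiff_cutMonomial (φ : ContDiffBump (0 : Euc N)) (m : ℕ) (i : Fin N) :
    ContDiff ℝ (⊤ : ℕ∞) (cutMonomial φ m i) := by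
  have h : ContDiff ℝ (⊤ : ℕ∞) fun x : Euc N => x i :=
    (EuclideanSpace.proj i : Euc N →L[ℝ] ℝ).contDiff
  exact φ.contDiff.mul ((h.pow m).div_const _)

lemma hasCompactSupport_cutMonomial (φ : ContDiffBump (0 : Euc N)) (m : ℕ) (i : Fin N) :
    HasCompactSupport (cutMonomial φ m i) :=
  φ.hasCompactSupport.mul_right

lemma cutMonomial_eventuallyEq (φ : ContDiffBump (0 : Euc N)) (m : ℕ) (i : Fin N) {x : Euc N}
    (hx : ‖x‖ < φ.rIn) : cutMonomial φ m i =ᶠ[𝓝 x] fun y => y i ^ m / m.factorial := by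
  have : Metric.ball (0 : Euc N) φ.rIn ∈ 𝓝 x := Metric.isOpen_ball.mem_nhds (by simpa using hx)
  filter_upwards [this] with y hy
  rw [cutMonomial, φ.one_of_mem_closedBall (Metric.ball_subset_closedBall hy), one_mul]

lemma tsupport_cutMonomial_subset (φ : ContDiffBump (0 : Euc N)) (m : ℕ) (i : Fin N) :
    tsupport (cutMonomial φ m i) ⊆ Metric.closedBall 0 φ.rOut := by
  rw [← φ.tsupport_eq]
  exact tsupport_mul_subset_left

end Atoms

/-! ### Averaging over phases -/

lemma sum_sin_quarter_phase (t : ℝ) : ∑ j : Fin 4, sin (t + (j : ℕ) * (π / 2)) = 0 := by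
  have h2 : t + 2 * (π / 2) = t + π := by ring
  have h3 : t + 3 * (π / 2) = t + π / 2 + π := by ring
  simp [Fin.sum_univ_four, h2, h3, sin_add_pi, sin_add_pi_div_two]

lemma sum_sin_sq_quarter_phase (t : ℝ) :
    ∑ j : Fin 4, sin (t + (j : ℕ) * (π / 2)) * sin (t + (j : ℕ) * (π / 2)) = 2 := by
  have h2 : t + 2 * (π / 2) = t + π := by ring
  have h3 : t + 3 * (π / 2) = t + π / 2 + π := by ring
  simp only [Fin.sum_univ_four, Fin.val_zero, Fin.val_one, Fin.val_two, Nat.cast_zero, zero_mul,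
    add_zero, Nat.cast_one, one_mul, Nat.cast_ofNat, h2,
    show ((3 : Fin 4) : ℕ) = 3 from rfl, h3, sin_add_pi, sin_add_pi_div_two]
  linarith [sin_sq_add_cos_sq t]

lemma sum_pi_prod {ι κ : Type*} [Fintype ι] [DecidableEq ι] [Fintype κ] (H : ι → κ → ℝ) :
    ∑ ω : ι → κ, ∏ i, H i (ω i) = ∏ i, ∑ j, H i j := by
  rw [Finset.prod_univ_sum, Fintype.piFinset_univ]

lemma sum_phase_mul {M : ℕ} {f : Fin M → Fin 4 → ℝ} (h0 : ∀ l, ∑ j, f l j = 0)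
    (h2 : ∀ l, ∑ j, f l j * f l j = 2) (l' l : Fin M) :
    ∑ ω : Fin M → Fin 4, f l' (ω l') * f l (ω l) = if l' = l then 4 ^ M / 2 else 0 := by
  have hprod : ∀ ω : Fin M → Fin 4, f l' (ω l') * f l (ω l) =
      ∏ i, (if i = l' then f l' (ω i) else 1) * (if i = l then f l (ω i) else 1) := by
    intro ω
    rw [Finset.prod_mul_distrib, Finset.prod_ite_eq' , Finset.prod_ite_eq']
    simp
  simp_rw [hprod]
  rw [sum_pi_prod fun i j => (if i = l' then f l' j else 1) * (if i = l then f l j else 1)]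
  split_ifs with h
  · subst h
    have : ∀ i, ∑ j, (if i = l' then f l' j else 1) * (if i = l' then f l' j else 1) =
        4 * if i = l' then (1 / 2 : ℝ) else 1 := by
      intro i
      split_ifs
      · rw [h2]; norm_num
      · simp
    simp_rw [this]
    rw [Finset.prod_mul_distrib, Finset.prod_ite_eq']
    simp
    ring
  · refine Finset.prod_eq_zero (Finset.mem_univ l') ?_
    simp [h, h0]

lemma sum_phases_prod {q M : ℕ} {f : Fin q → Fin M → Fin 4 → ℝ} (h0 : ∀ i l, ∑ j, f i l j = 0)
    (h2 : ∀ i l, ∑ j, f i l j * f i l j = 2) (c d : Fin M → ℝ) :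
    ∑ ω : Fin q → Fin M → Fin 4,
      (∏ i, ∑ l, c l * f i l (ω i l)) * ∑ l, d l * ∏ i, f i l (ω i l) =
        (4 ^ M / 2) ^ q * ∑ l, d l * c l ^ q := by
  simp_rw [Finset.mul_sum]
  rw [Finset.sum_comm]
  refine Finset.sum_congr rfl fun l _ => ?_
  have h : ∀ ω : Fin q → Fin M → Fin 4,
      (∏ i, ∑ l', c l' * f i l' (ω i l')) * (d l * ∏ i, f i l (ω i l)) =
        d l * ∏ i, (∑ l', c l' * f i l' (ω i l')) * f i l (ω i l) := by
    intro ω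
    rw [Finset.prod_mul_distrib]
    ring
  simp_rw [h]
  rw [← Finset.mul_sum,
    sum_pi_prod fun i (η : Fin M → Fin 4) => (∑ l', c l' * f i l' (η l')) * f i l (η l)]
  have h1 : ∀ i, ∑ η : Fin M → Fin 4, (∑ l', c l' * f i l' (η l')) * f i l (η l) =
      c l * (4 ^ M / 2) := by
    intro i
    simp_rw [Finset.sum_mul]
    rw [Finset.sum_comm]
    simp_rw [mul_assoc, ← Finset.mul_sum, sum_phase_mul (h0 i) (h2 i)]
    simp
  simp_rw [h1]
  rw [Finset.prod_const, Finset.card_univ, Fintype.card_fin]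
  ring

/-! ### Oscillating family -/

section Oscillating

variable {N n m q : ℕ}

/-- A map with `q` plane waves of frequency `ν` as first components, and their product, cut off and
multiplied by a monomial, as component `q + 1`. -/
def waveAtom (hn : q + 1 ≤ n) (hN : q + 1 ≤ N) (m : ℕ) (φ : ContDiffBump (0 : Euc N)) (ν : ℝ)
    (θ : Fin q → ℝ) : Euc N → Fin n → ℝ :=
  padComponents hn (Fin.snoc (α := fun _ => Euc N → ℝ)
    (fun i x => sin (ν * x (Fin.castLE hN i.castSucc) + (θ i - m * (π / 2))))
    fun x => cutMonomial φ m (Fin.castLE hN (Fin.last q)) x *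
      ∏ i : Fin q, sin (ν * x (Fin.castLE hN i.castSucc) + θ i))

lemma waveAtom_castSucc (hn : q + 1 ≤ n) (hN : q + 1 ≤ N) (φ : ContDiffBump (0 : Euc N)) (ν : ℝ)
    (θ : Fin q → ℝ) (x : Euc N) (i : Fin q) :
    waveAtom hn hN m φ ν θ x (Fin.castLE hn i.castSucc) =
      sin (ν * x (Fin.castLE hN i.castSucc) + (θ i - m * (π / 2))) := by
  rw [waveAtom, padComponents_castLE, Fin.snoc_castSucc]

lemma waveAtom_last (hn : q + 1 ≤ n) (hN : q + 1 ≤ N) (φ : ContDiffBump (0 : Euc N)) (ν : ℝ)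
    (θ : Fin q → ℝ) (x : Euc N) :
    waveAtom hn hN m φ ν θ x (Fin.castLE hn (Fin.last q)) =
      cutMonomial φ m (Fin.castLE hN (Fin.last q)) x *
        ∏ i : Fin q, sin (ν * x (Fin.castLE hN i.castSucc) + θ i) := by
  rw [waveAtom, padComponents_castLE, Fin.snoc_last]

lemma exists_atomBound_waveAtom (hn : q + 1 ≤ n) (hN : q + 1 ≤ N) (m : ℕ)
    (φ : ContDiffBump (0 : Euc N)) :
    ∃ K : ℕ → ℝ, (∀ j, 0 ≤ K j) ∧ ∀ ν : ℝ, 1 ≤ ν → ∀ θ : Fin q → ℝ,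
      AtomBound K ν (waveAtom hn hN m φ ν θ) := by
  obtain ⟨K₀, hK₀, h₀⟩ := exists_atomBound_of_hasCompactSupport
    (contDiff_cutMonomial φ m (Fin.castLE hN (Fin.last q)))
    (hasCompactSupport_cutMonomial φ m (Fin.castLE hN (Fin.last q)))
  obtain ⟨K₁, hK₁, h₁⟩ := exists_atomBound_prod (N := N) (K := fun _ => 1)
    (fun _ => zero_le_one) q
  set K₂ : ℕ → ℝ := fun j => ∑ i ∈ Finset.range (j + 1), j.choose i * K₀ i * K₁ (j - i) with hK₂
  have hK₂0 : ∀ j, 0 ≤ K₂ j := fun j => Finset.sum_nonneg fun i _ => by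
    have := hK₀ i
    have := hK₁ (j - i)
    positivity
  refine ⟨fun j => ((q + 1 : ℕ) : ℝ) * (1 + K₂ j), fun j => by have := hK₂0 j; positivity,
    fun ν hν θ => ?_⟩
  have hν0 : 0 ≤ ν := zero_le_one.trans hν
  refine AtomBound.padComponents (K := fun j => 1 + K₂ j) hn fun k => ?_
  refine Fin.lastCases ?_ (fun i => ?_) k
  · rw [Fin.snoc_last]
    exact ((h₀.mono_scale zero_le_one hν hK₀).mul
      (h₁ ν hν0 _ fun i => atomBound_sin_coord _ hν0 _)).mono hν0 fun j => by simp [hK₂]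
  · rw [Fin.snoc_castSucc]
    exact (atomBound_sin_coord _ hν0 _).mono hν0 fun j => by linarith [hK₂0 j]

lemma lacSum_apply {M : ℕ} (s a : ℝ) (e : Fin M → ℕ) (v : Fin M → Euc N → Fin n → ℝ) (x : Euc N)
    (k : Fin n) : lacSum s a e v x k = ∑ l, a * ((2 : ℝ) ^ e l) ^ (-s) * v l x k := by
  simp [lacSum, Finset.sum_apply]

lemma jacMinor_lacSum_waveAtom {M : ℕ} (hn : q + 1 ≤ n) (hN : q + 1 ≤ N)
    (φ : ContDiffBump (0 : Euc N)) (s a : ℝ) (e : Fin M → ℕ) (θ : Fin M → Fin q → ℝ)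
    {x : Euc N} (hx : ‖x‖ < φ.rIn) :
    jacMinor m (q + 1) (Fin.castLE hn) (fun _ => Fin.castLE hN)
        (lacSum s a e fun l => waveAtom hn hN m φ (2 ^ e l) (θ l)) x =
      (∏ i : Fin q, ∑ l, a * ((2 : ℝ) ^ e l) ^ (-s) * (2 ^ e l) ^ m *
        sin (2 ^ e l * x (Fin.castLE hN i.castSucc) + θ l i)) *
      ∑ l, a * ((2 : ℝ) ^ e l) ^ (-s) *
        ∏ i : Fin q, sin (2 ^ e l * x (Fin.castLE hN i.castSucc) + θ l i) := by
  set c : Fin M → ℝ := fun l => a * ((2 : ℝ) ^ e l) ^ (-s) with hc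
  set u := lacSum s a e fun l => waveAtom hn hN m φ (2 ^ e l) (θ l) with hu
  let G : Fin q → ℝ → ℝ := fun i t => ∑ l, c l * sin (2 ^ e l * t + (θ l i - m * (π / 2)))
  have hG : ∀ i, ContDiff ℝ (⊤ : ℕ∞) (G i) := fun i =>
    ContDiff.sum fun l _ => contDiff_const.mul (contDiff_sin_affine _ _)
  have hui : ∀ i : Fin q, (fun y => u y (Fin.castLE hn i.castSucc)) =
      fun y => G i (y (Fin.castLE hN i.castSucc)) := by
    intro i
    funext y
    simp only [hu, lacSum_apply, waveAtom_castSucc, G, hc]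
  let P : Euc N → ℝ := fun y =>
    ∑ l, c l * ∏ i : Fin q, sin (2 ^ e l * y (Fin.castLE hN i.castSucc) + θ l i)
  have hur : (fun y => u y (Fin.castLE hn (Fin.last q))) =ᶠ[𝓝 x]
      fun y => (fun t : ℝ => (1 * t) ^ m / m.factorial) (y (Fin.castLE hN (Fin.last q))) * P y := by
    filter_upwards [cutMonomial_eventuallyEq φ m (Fin.castLE hN (Fin.last q)) hx] with y hy
    simp only [hu, lacSum_apply, waveAtom_last, hy, P, hc, Finset.mul_sum, one_mul]
    exact Finset.sum_congr rfl fun l _ => by ring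
  have hP : Differentiable ℝ P := by fun_prop
  have hPi : ∀ y (t : ℝ), P (y + t • EuclideanSpace.single (Fin.castLE hN (Fin.last q)) 1) = P y := by
    intro y t
    have h : ∀ i : Fin q, Fin.castLE hN i.castSucc ≠ Fin.castLE hN (Fin.last q) := fun i h =>
      (Fin.castSucc_lt_last i).ne (Fin.castLE_injective hN h)
    simp [P, h, -Fin.castLE_castSucc]
  rw [jacMinor_eq_prod, Fin.prod_univ_castSucc]
  · congr 1
    · refine Finset.prod_congr rfl fun i _ => ?_
      rw [hui, pderivList_comp_coord (hG i)]
      simp only [List.mem_replicate, and_imp, List.length_replicate]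
      rw [if_pos fun j _ h => h]
      simp only [G]
      rw [iteratedDeriv_fun_sum fun l _ =>
        (contDiff_const.mul (contDiff_sin_affine _ _)).contDiffAt]
      refine Finset.sum_congr rfl fun l _ => ?_
      rw [iteratedDeriv_const_mul_field, iteratedDeriv_sin_phase, ← mul_assoc]
    · rw [(pderivList_congr hur _).self_of_nhds, pderivList_replicate_mul
        (g := fun t => (1 * t) ^ m / m.factorial) (by fun_prop) hP _ hPi,
        iteratedDeriv_pow_div_factorial]
      simp [P, c]
  · rintro k l - ⟨j, hj, hjk⟩
    rw [hui, pderivList_comp_coord (hG k)]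
    exact if_neg fun h => hjk (h j hj)

lemma sobNorm_nonneg {F : Type*} [NormedAddCommGroup F] [NormedSpace ℝ F] (Ω : Set (Euc N))
    (s p : ℝ) (u : Euc N → F) : 0 ≤ sobNorm Ω s p u := by
  have h : ∀ k, 0 ≤ intSobNorm Ω k p u := fun k => Finset.sum_nonneg fun j _ =>
    rpow_nonneg (integral_nonneg fun x => by positivity) _
  unfold sobNorm
  split_ifs
  · exact h _
  · exact add_nonneg (h _) (rpow_nonneg
      (integral_nonneg fun x => integral_nonneg fun y => by positivity) _)

lemma exists_oscillating (hn : q + 1 ≤ n) (hN : q + 1 ≤ N) (m : ℕ) {s p : ℝ} (hs : 0 < s)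
    (hp : 1 < p) {Ω : Set (Euc N)} (hΩ : MeasurableSet Ω) (hΩb : Bornology.IsBounded Ω)
    (φ : ContDiffBump (0 : Euc N)) {ψ : Euc N → ℝ} (hψ : Continuous ψ)
    (hψc : HasCompactSupport ψ) (hψφ : ∀ x, φ.rIn ≤ ‖x‖ → ψ x = 0) :
    ∃ C : ℝ, ∀ (M : ℕ) (e : Fin M → ℕ) (a : ℝ), 1 ≤ M → e.Injective →
      ((∃ k : ℕ, s = k) → M = 1) → 0 ≤ a → ∃ u : Euc N → Fin n → ℝ,
        ContDiff ℝ (⊤ : ℕ∞) u ∧ sobNorm Ω s p u ≤ C * (a * (M : ℝ) ^ (1 / p)) ∧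
        (1 / 2) ^ q * (∫ x in Ω, ψ x) *
            (a ^ (q + 1) * ∑ l, ((2 : ℝ) ^ e l) ^ ((m : ℝ) * q - s * (q + 1))) ≤
          ∫ x in Ω, jacMinor m (q + 1) (Fin.castLE hn) (fun _ => Fin.castLE hN) u x * ψ x := by
  obtain ⟨K, hK, hKw⟩ := exists_atomBound_waveAtom hn hN m φ
  obtain ⟨C, hC, hCs⟩ := sobNorm_lacSum_le (F := Fin n → ℝ) (N := N) (by omega) hs hp hK
  refine ⟨C * volume.real Ω ^ (1 / p), fun M e a hM he hsM ha => ?_⟩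
  let θ : (Fin q → Fin M → Fin 4) → Fin M → Fin q → ℝ := fun ω l i => (ω i l : ℕ) * (π / 2)
  let u : (Fin q → Fin M → Fin 4) → Euc N → Fin n → ℝ := fun ω =>
    lacSum s a e fun l => waveAtom hn hN m φ (2 ^ e l) (θ ω l)
  have hat : ∀ ω l, AtomBound K (2 ^ e l) (waveAtom hn hN m φ (2 ^ e l) (θ ω l)) := fun ω l =>
    hKw _ (one_le_pow₀ one_le_two) _
  let c : Fin M → ℝ := fun l => a * ((2 : ℝ) ^ e l) ^ (-s)
  let S : Fin q → Fin M → Fin 4 → Euc N → ℝ := fun i l j x =>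
    sin (2 ^ e l * x (Fin.castLE hN i.castSucc) + (j : ℕ) * (π / 2))
  let W : (Fin q → Fin M → Fin 4) → Euc N → ℝ := fun ω x =>
    (∏ i, ∑ l, c l * (2 ^ e l) ^ m * S i l (ω i l) x) * ∑ l, c l * ∏ i, S i l (ω i l) x
  have hJ : ∀ ω x, jacMinor m (q + 1) (Fin.castLE hn) (fun _ => Fin.castLE hN) (u ω) x * ψ x =
      W ω x * ψ x := by
    intro ω x
    rcases lt_or_ge ‖x‖ φ.rIn with hx | hx
    · rw [jacMinor_lacSum_waveAtom hn hN φ s a e (θ ω) hx]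
    · rw [hψφ x hx, mul_zero, mul_zero]
  have hWc : ∀ ω, Continuous (W ω) := fun ω => by fun_prop
  have hWi : ∀ ω, IntegrableOn (fun x => W ω x * ψ x) Ω := fun ω =>
    (((hWc ω).mul hψ).integrable_of_hasCompactSupport hψc.mul_left).integrableOn
  have hsum : ∀ x, ∑ ω, W ω x =
      (4 ^ M / 2) ^ q * ∑ l, c l * (c l * (2 ^ e l) ^ m) ^ q := fun x =>
    sum_phases_prod (fun i l => sum_sin_quarter_phase _) (fun i l => sum_sin_sq_quarter_phase _)
      (fun l => c l * (2 ^ e l) ^ m) c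
  have hterm : ∀ l, c l * (c l * (2 ^ e l) ^ m) ^ q =
      a ^ (q + 1) * ((2 : ℝ) ^ e l) ^ ((m : ℝ) * q - s * (q + 1)) := by
    intro l
    have h2 : (0 : ℝ) < 2 ^ e l := by positivity
    have h3 : ((2 : ℝ) ^ e l) ^ ((m : ℝ) * q - s * (q + 1)) =
        ((2 ^ e l) ^ m) ^ q * (((2 : ℝ) ^ e l) ^ (-s)) ^ (q + 1) := by
      rw [← rpow_natCast (((2 : ℝ) ^ e l) ^ (-s)), ← rpow_mul h2.le, ← pow_mul,
        ← rpow_natCast ((2 : ℝ) ^ e l) (m * q), ← rpow_add h2]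
      congr 1
      push_cast
      ring
    rw [h3]
    simp only [c]
    ring
  obtain ⟨ω, -, hω⟩ := Finset.exists_le_of_sum_le (s := Finset.univ)
    (f := fun _ : Fin q → Fin M → Fin 4 => (1 / 2) ^ q * (∫ x in Ω, ψ x) *
      (a ^ (q + 1) * ∑ l, ((2 : ℝ) ^ e l) ^ ((m : ℝ) * q - s * (q + 1))))
    (g := fun ω => ∫ x in Ω, W ω x * ψ x) Finset.univ_nonempty (by
      rw [← integral_finsetSum _ fun ω _ => hWi ω]
      simp_rw [← Finset.sum_mul, hsum, hterm, ← Finset.mul_sum]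
      rw [integral_const_mul, Finset.sum_const, Finset.card_univ]
      simp only [Fintype.card_pi, Fintype.card_fin, Finset.prod_const, Finset.card_univ, nsmul_eq_mul]
      push_cast
      apply le_of_eq
      rw [div_eq_mul_one_div, mul_pow]
      ring)
  refine ⟨u ω, contDiff_lacSum fun l => (hat ω l).1, ?_, ?_⟩
  · refine (hCs Ω Set.univ hΩ hΩb MeasurableSet.univ M e _ a hM he hsM ha (hat ω)
      fun i j x hx => absurd (Set.mem_univ x) hx).trans_eq ?_
    rw [Set.univ_inter, mul_rpow (by positivity) measureReal_nonneg]
    ring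
  · simp_rw [hJ]
    exact hω

end Oscillating

/-! ### Concentrating family -/

section Concentrating

variable {N n m q : ℕ}

lemma hyperDet_eq_zero_of_last {m q : ℕ} {A : (Fin (m + 1) → Fin (q + 1)) → ℝ}
    (hA : ∀ l : Fin m → Fin (q + 1), A (Fin.cons (Fin.last q) l) = 0) : hyperDet A = 0 := by
  rw [hyperDet]
  exact Finset.sum_eq_zero fun τ _ =>
    mul_eq_zero_of_right _ (Finset.prod_eq_zero (Finset.mem_univ (Fin.last q)) (hA _))

/-- A map with cut off monomials as first `q` components, and a bump function as component
`q + 1`, both dilated by `ν`. -/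
def bumpAtom (hn : q + 1 ≤ n) (hN : q + 1 ≤ N) (m : ℕ) (φ b : ContDiffBump (0 : Euc N)) (ν : ℝ) :
    Euc N → Fin n → ℝ :=
  padComponents hn (Fin.snoc (α := fun _ => Euc N → ℝ)
    (fun i x => cutMonomial φ m (Fin.castLE hN i.castSucc) (ν • x)) fun x => (-1) ^ m * b (ν • x))

lemma bumpAtom_castSucc (hn : q + 1 ≤ n) (hN : q + 1 ≤ N) (φ b : ContDiffBump (0 : Euc N)) (ν : ℝ)
    (x : Euc N) (i : Fin q) : bumpAtom hn hN m φ b ν x (Fin.castLE hn i.castSucc) =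
      cutMonomial φ m (Fin.castLE hN i.castSucc) (ν • x) := by
  rw [bumpAtom, padComponents_castLE, Fin.snoc_castSucc]

lemma bumpAtom_last (hn : q + 1 ≤ n) (hN : q + 1 ≤ N) (φ b : ContDiffBump (0 : Euc N)) (ν : ℝ)
    (x : Euc N) : bumpAtom hn hN m φ b ν x (Fin.castLE hn (Fin.last q)) =
      (-1) ^ m * b (ν • x) := by
  rw [bumpAtom, padComponents_castLE, Fin.snoc_last]

lemma bumpAtom_eq_zero (hn : q + 1 ≤ n) (hN : q + 1 ≤ N) {φ b : ContDiffBump (0 : Euc N)}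
    (hbφ : b.rOut ≤ φ.rOut) {ν : ℝ} (hν : 0 < ν) {x : Euc N}
    (hx : x ∉ Metric.closedBall 0 (φ.rOut / ν)) : bumpAtom hn hN m φ b ν x = 0 := by
  have h : φ.rOut ≤ ‖ν • x‖ := by
    rw [mem_closedBall_zero_iff, not_le, div_lt_iff₀ hν] at hx
    rw [norm_smul, norm_of_nonneg hν.le]
    linarith
  rw [bumpAtom, padComponents]
  refine Finset.sum_eq_zero fun k _ => ?_
  rw [smul_eq_zero]
  left
  refine Fin.lastCases ?_ (fun i => ?_) k
  · rw [Fin.snoc_last, b.zero_of_le_dist (by simpa using hbφ.trans h), mul_zero]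
  · rw [Fin.snoc_castSucc, cutMonomial, φ.zero_of_le_dist (by simpa using h), zero_mul]

lemma exists_atomBound_bumpAtom (hn : q + 1 ≤ n) (hN : q + 1 ≤ N) (m : ℕ)
    (φ b : ContDiffBump (0 : Euc N)) :
    ∃ K : ℕ → ℝ, (∀ j, 0 ≤ K j) ∧ ∀ ν : ℝ, 0 ≤ ν → AtomBound K ν (bumpAtom hn hN m φ b ν) := by
  choose K₀ hK₀ h₀ using fun i : Fin q => exists_atomBound_of_hasCompactSupport
    (contDiff_cutMonomial φ m (Fin.castLE hN i.castSucc))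
    (hasCompactSupport_cutMonomial φ m (Fin.castLE hN i.castSucc))
  obtain ⟨K₁, hK₁, h₁⟩ := exists_atomBound_of_hasCompactSupport
    (f := fun x => (-1) ^ m * b x) (contDiff_const.mul b.contDiff) b.hasCompactSupport.mul_left
  have hsum : ∀ j, 0 ≤ ∑ i, K₀ i j := fun j => Finset.sum_nonneg fun i _ => hK₀ i j
  refine ⟨fun j => ((q + 1 : ℕ) : ℝ) * (K₁ j + ∑ i, K₀ i j), fun j => ?_, fun ν hν => ?_⟩
  · have := hK₁ j
    have := hsum j
    positivity
  refine AtomBound.padComponents (K := fun j => K₁ j + ∑ i, K₀ i j) hn fun k => ?_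
  refine Fin.lastCases ?_ (fun i => ?_) k
  · rw [Fin.snoc_last]
    exact (h₁.comp_smul hν).mono hν fun j => by linarith [hsum j]
  · rw [Fin.snoc_castSucc]
    exact ((h₀ i).comp_smul hν).mono hν fun j => by
      linarith [hK₁ j, Finset.single_le_sum (f := fun i => K₀ i j) (fun i _ => hK₀ i j)
        (Finset.mem_univ i)]

lemma jacMinor_const_smul_bumpAtom (hn : q + 1 ≤ n) (hN : q + 1 ≤ N)
    {φ b : ContDiffBump (0 : Euc N)} (hbφ : b.rOut < φ.rIn) (c ν : ℝ) (x : Euc N) :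
    jacMinor m (q + 1) (Fin.castLE hn) (fun _ => Fin.castLE hN)
        (fun y => c • bumpAtom hn hN m φ b ν y) x =
      (c * ν ^ m) ^ q * pderivList (List.replicate m (Fin.castLE hN (Fin.last q)))
        (fun y => c * ((-1) ^ m * b (ν • y))) x := by
  have hlast : (fun y => (c • bumpAtom hn hN m φ b ν y) (Fin.castLE hn (Fin.last q))) =
      fun y => c * ((-1) ^ m * b (ν • y)) := by
    funext y
    rw [Pi.smul_apply, bumpAtom_last, smul_eq_mul]
  rcases lt_or_ge ‖ν • x‖ φ.rIn with hx | hx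
  · let g : ℝ → ℝ := fun t => c * ((ν * t) ^ m / m.factorial)
    have hg : ContDiff ℝ (⊤ : ℕ∞) g := by fun_prop
    have hi : ∀ i : Fin q,
        (fun y => (c • bumpAtom hn hN m φ b ν y) (Fin.castLE hn i.castSucc)) =ᶠ[𝓝 x]
          fun y => g (y (Fin.castLE hN i.castSucc)) := by
      intro i
      have ht : Tendsto (fun y : Euc N => ν • y) (𝓝 x) (𝓝 (ν • x)) :=
        (continuous_const_smul ν).tendsto x
      filter_upwards [ht.eventually (cutMonomial_eventuallyEq φ m (Fin.castLE hN i.castSucc) hx)]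
        with y hy
      rw [Pi.smul_apply, bumpAtom_castSucc, hy, smul_eq_mul, PiLp.smul_apply, smul_eq_mul]
    rw [jacMinor_eq_prod, Fin.prod_univ_castSucc, hlast]
    · congr 1
      refine (Finset.prod_congr rfl fun i _ => ?_).trans (Fin.prod_const q (c * ν ^ m))
      rw [(pderivList_congr (hi i) _).self_of_nhds, pderivList_comp_coord hg]
      simp only [List.mem_replicate, and_imp, List.length_replicate]
      rw [if_pos fun j _ h => h, iteratedDeriv_const_mul_field, iteratedDeriv_pow_div_factorial]
    · rintro k l - ⟨j, hj, hjk⟩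
      rw [(pderivList_congr (hi k) _).self_of_nhds, pderivList_comp_coord hg]
      exact if_neg fun h => hjk (h j hj)
  · have h0 : (fun y => c * ((-1) ^ m * b (ν • y))) =ᶠ[𝓝 x] fun _ => 0 := by
      have ht : ∀ᶠ y in 𝓝 x, b.rOut < ‖ν • y‖ :=
        (by fun_prop : Continuous fun y : Euc N => ‖ν • y‖).continuousAt.eventually_const_lt
          (hbφ.trans_le hx)
      filter_upwards [ht] with y hy
      rw [b.zero_of_le_dist (by simpa using hy.le), mul_zero, mul_zero]
    have hz : ∀ l, pderivList l (fun y => c * ((-1) ^ m * b (ν • y))) x = 0 := fun l => by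
      rw [(pderivList_congr h0 l).self_of_nhds, pderivList_zero]
    rw [hz, mul_zero, jacMinor]
    refine hyperDet_eq_zero_of_last fun l => ?_
    simp only [Fin.cons_zero, hlast, hz]

lemma pderivList_cutMonomial (φ : ContDiffBump (0 : Euc N)) (m : ℕ) (i : Fin N) {x : Euc N}
    (hx : ‖x‖ < φ.rIn) : pderivList (List.replicate m i) (cutMonomial φ m i) x = 1 := by
  rw [(pderivList_congr (cutMonomial_eventuallyEq φ m i hx) _).self_of_nhds,
    pderivList_comp_coord (g := fun t => t ^ m / m.factorial) (by fun_prop)]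
  simp only [List.mem_replicate, and_imp, List.length_replicate]
  rw [if_pos fun j _ h => h]
  simpa using congrFun (iteratedDeriv_pow_div_factorial 1 m) (x i)

lemma integral_jacMinor_const_smul_bumpAtom (hn : q + 1 ≤ n) (hN : q + 1 ≤ N)
    {φ b : ContDiffBump (0 : Euc N)} (hbφ : b.rOut < φ.rIn) (c : ℝ) {ν : ℝ} (hν : 1 ≤ ν) :
    ∫ x, jacMinor m (q + 1) (Fin.castLE hn) (fun _ => Fin.castLE hN)
        (fun y => c • bumpAtom hn hN m φ b ν y) x *
          cutMonomial φ m (Fin.castLE hN (Fin.last q)) x =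
      c ^ (q + 1) * (ν ^ m) ^ q * (ν ^ N)⁻¹ * ∫ x, b x := by
  have hν0 : 0 < ν := zero_lt_one.trans_le hν
  have hf : ContDiff ℝ (⊤ : ℕ∞) fun y : Euc N => c * ((-1) ^ m * b (ν • y)) :=
    contDiff_const.mul (contDiff_const.mul (b.contDiff.comp (contDiff_const_smul ν)))
  have hfc : HasCompactSupport fun y : Euc N => c * ((-1) ^ m * b (ν • y)) :=
    ((b.hasCompactSupport.comp_smul hν0.ne').mul_left).mul_left
  simp_rw [jacMinor_const_smul_bumpAtom hn hN hbφ c ν, mul_assoc ((c * ν ^ m) ^ q)]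
  rw [integral_const_mul,
    integral_pderivList_replicate_mul hf hfc (contDiff_cutMonomial φ m _)]
  have h1 : ∀ x : Euc N, c * ((-1) ^ m * b (ν • x)) *
      pderivList (List.replicate m (Fin.castLE hN (Fin.last q)))
        (cutMonomial φ m (Fin.castLE hN (Fin.last q))) x = c * (-1) ^ m * b (ν • x) := by
    intro x
    rcases lt_or_ge ‖x‖ φ.rIn with hx | hx
    · rw [pderivList_cutMonomial φ m _ hx]
      ring
    · have : b.rOut ≤ ‖ν • x‖ := by
        rw [norm_smul, norm_of_nonneg hν0.le]
        nlinarith [norm_nonneg x]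
      rw [b.zero_of_le_dist (by simpa using this)]
      ring
  simp_rw [h1]
  rw [integral_const_mul, Measure.integral_comp_smul, finrank_euclideanSpace, Fintype.card_fin,
    smul_eq_mul, abs_of_pos (by positivity)]
  have h2 : ((-1 : ℝ) ^ m) * (-1) ^ m = 1 := by rw [← mul_pow]; norm_num
  linear_combination c * (c * ν ^ m) ^ q * (ν ^ N)⁻¹ * (∫ x, b x) * h2

lemma exists_concentrating (hn : q + 1 ≤ n) (hN : q + 1 ≤ N) (m : ℕ) {s p : ℝ} (hs : 0 < s)
    (hp : 1 < p) {Ω : Set (Euc N)} (hΩ : MeasurableSet Ω) (hΩb : Bornology.IsBounded Ω)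
    {φ b : ContDiffBump (0 : Euc N)} (hbφ : b.rOut < φ.rIn)
    (hφΩ : Metric.closedBall 0 φ.rOut ⊆ Ω) :
    ∃ C : ℝ, ∀ (k : ℕ) (a : ℝ), 0 ≤ a → ∃ u : Euc N → Fin n → ℝ,
        ContDiff ℝ (⊤ : ℕ∞) u ∧ sobNorm Ω s p u ≤ C * (a * ((2 : ℝ) ^ k) ^ (-(N / p))) ∧
        ∫ x in Ω, jacMinor m (q + 1) (Fin.castLE hn) (fun _ => Fin.castLE hN) u x *
            cutMonomial φ m (Fin.castLE hN (Fin.last q)) x =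
          (∫ x, b x) * (a ^ (q + 1) * ((2 : ℝ) ^ k) ^ ((m : ℝ) * q - s * (q + 1) - N)) := by
  obtain ⟨K, hK, hKw⟩ := exists_atomBound_bumpAtom hn hN m φ b
  obtain ⟨C, hC, hCs⟩ := sobNorm_lacSum_le (F := Fin n → ℝ) (N := N) (by omega) hs hp hK
  set V := volume.real (Metric.closedBall (0 : Euc N) φ.rOut) with hV
  refine ⟨C * V ^ (1 / p), fun k a ha => ?_⟩
  set ν : ℝ := 2 ^ k with hνk
  have hν : 1 ≤ ν := one_le_pow₀ one_le_two
  have hν0 : 0 < ν := zero_lt_one.trans_le hν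
  have hat := hKw ν hν0.le
  have hu : (lacSum s a (fun _ : Fin 1 => k) fun _ => bumpAtom hn hN m φ b ν) =
      fun y => (a * ν ^ (-s)) • bumpAtom hn hN m φ b ν y := by
    funext y
    simp [lacSum, hνk]
  refine ⟨lacSum s a (fun _ : Fin 1 => k) fun _ => bumpAtom hn hN m φ b ν,
    contDiff_lacSum fun _ => hat.1, ?_, ?_⟩
  · have hVν : volume.real (Metric.closedBall (0 : Euc N) (φ.rOut / ν)) = V * ν ^ (-(N : ℝ)) := by
      rw [hV, measureReal_def, measureReal_def,
        Measure.addHaar_closedBall _ _ (div_nonneg φ.rOut_pos.le hν0.le),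
        Measure.addHaar_closedBall _ _ φ.rOut_pos.le, ENNReal.toReal_mul, ENNReal.toReal_mul,
        ENNReal.toReal_ofReal (by have := φ.rOut_pos; positivity),
        ENNReal.toReal_ofReal (by have := φ.rOut_pos; positivity), finrank_euclideanSpace,
        Fintype.card_fin, rpow_neg hν0.le, rpow_natCast, div_pow]
      ring
    have hvol : volume.real (Metric.closedBall (0 : Euc N) (φ.rOut / ν) ∩ Ω) ≤
        V * ν ^ (-(N : ℝ)) := by
      rw [← hVν]
      exact measureReal_mono Set.inter_subset_left (measure_closedBall_lt_top.ne)
    calc sobNorm Ω s p (lacSum s a (fun _ : Fin 1 => k) fun _ => bumpAtom hn hN m φ b ν)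
        ≤ C * a * (((1 : ℕ) : ℝ) *
          volume.real (Metric.closedBall (0 : Euc N) (φ.rOut / ν) ∩ Ω)) ^ (1 / p) :=
          hCs Ω _ hΩ hΩb Metric.isClosed_closedBall.measurableSet 1 _ _ a le_rfl
            (Function.injective_of_subsingleton _) (fun _ => rfl) ha (fun _ => hat)
            fun _ j x hx => iteratedFDeriv_eq_zero_of_notMem Metric.isClosed_closedBall
              (fun y hy => bumpAtom_eq_zero hn hN (hbφ.trans φ.rIn_lt_rOut).le hν0 hy) j hx
      _ ≤ C * a * (V * ν ^ (-(N : ℝ))) ^ (1 / p) := by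
          rw [Nat.cast_one, one_mul]
          gcongr
      _ = _ := by
          rw [mul_rpow measureReal_nonneg (by positivity), ← rpow_mul hν0.le]
          rw [show -(N : ℝ) * (1 / p) = -(N / p) by ring]
          ring
  · have hφ0 : ∀ x ∉ Ω, cutMonomial φ m (Fin.castLE hN (Fin.last q)) x = 0 := fun x hx =>
      image_eq_zero_of_notMem_tsupport fun h => hx (hφΩ (tsupport_cutMonomial_subset φ m _ h))
    rw [setIntegral_eq_integral_of_forall_compl_eq_zero fun x hx => by rw [hφ0 x hx, mul_zero],
      hu, integral_jacMinor_const_smul_bumpAtom hn hN hbφ _ hν, mul_pow]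
    have h3 : ν ^ ((m : ℝ) * q - s * (q + 1) - N) =
        (ν ^ (-s)) ^ (q + 1) * (ν ^ m) ^ q * (ν ^ N)⁻¹ := by
      rw [← rpow_natCast (ν ^ (-s)), ← rpow_mul hν0.le, ← pow_mul, ← rpow_natCast ν (m * q),
        ← rpow_natCast ν N, ← rpow_neg hν0.le, ← rpow_add hν0, ← rpow_add hν0]
      congr 1
      push_cast
      ring
    rw [h3]
    ring

end Concentrating

/-- Theorem 1.3: for `m = 1` or `m = 2`, if `W^{s,p} ⊄ W^{m-m/r,r}` (equivalently,
`s - m + m/r < max{0, N/p - N/r}` or (`p > r` and `s = m - m/r` non-integer)), then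
there are `u_k ∈ C^m(Ω̄,ℝ^n)`, minors `(β, α)` and `ψ ∈ C_c^∞(Ω)` with
`‖u_k‖_{W^{s,p}} → 0` and `∫_Ω M^β_α(D^m u_k) ψ → ∞`. -/
theorem stmt15 (N n m r : ℕ) (hN : 2 ≤ N) (hn : 1 ≤ n) (hm : m = 1 ∨ m = 2)
    (hr1 : 1 < r) (hr : r ≤ min n N)
    (Ω : Set (Euc N)) (hΩ : IsSmoothDomain Ω)
    (hbox : {x : Euc N | ∀ i, |x i| < 8} ⊆ Ω)
    (p s : ℝ) (hp1 : 1 < p) (hs0 : 0 < s)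
    (hnotembed :
      s - m + (m : ℝ) / r < max 0 ((N : ℝ) / p - (N : ℝ) / r) ∨
        ((r : ℝ) < p ∧ s = (m : ℝ) - (m : ℝ) / r ∧ ¬∃ k : ℕ, s = k)) :
    ∃ (u : ℕ → Euc N → Fin n → ℝ) (β : Fin r → Fin n)
      (α : Fin m → Fin r → Fin N) (ψ : Euc N → ℝ),
      (∀ k, ContDiffOn ℝ m (u k) (closure Ω)) ∧
      StrictMono β ∧ (∀ j, StrictMono (α j)) ∧ IsCinfc Ω ψ ∧
      Tendsto (fun k => sobNorm Ω s p (u k)) atTop (𝓝 0) ∧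
      Tendsto (fun k => ∫ x in Ω, jacMinor m r β α (u k) x * ψ x) atTop atTop := by
  obtain ⟨q, rfl⟩ : ∃ q, r = q + 1 := ⟨r - 1, by omega⟩
  have hn' : q + 1 ≤ n := hr.trans (min_le_left _ _)
  have hN' : q + 1 ≤ N := hr.trans (min_le_right _ _)
  have hΩm : MeasurableSet Ω := hΩ.1.measurableSet
  have hr0 : (0 : ℝ) < (q : ℝ) + 1 := by positivity
  push_cast at hnotembed
  have hball : Metric.closedBall (0 : Euc N) 4 ⊆ Ω := fun x hx => hbox fun i => by
    have h1 := PiLp.norm_apply_le x i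
    rw [mem_closedBall_zero_iff] at hx
    rw [← norm_eq_abs]
    linarith
  let φ : ContDiffBump (0 : Euc N) := ⟨3, 4, by norm_num, by norm_num⟩
  let b : ContDiffBump (0 : Euc N) := ⟨1, 2, by norm_num, by norm_num⟩
  have hbs : Function.support b ⊆ Ω := fun x hx => hball <| by
    rw [b.support_eq] at hx
    exact Metric.closedBall_subset_closedBall (by norm_num : (2 : ℝ) ≤ 4)
      (Metric.ball_subset_closedBall hx)
  have hbcinfc : IsCinfc Ω b := ⟨b.contDiff, b.hasCompactSupport, by
    rw [b.tsupport_eq]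
    exact (Metric.closedBall_subset_closedBall (by norm_num : (2 : ℝ) ≤ 4)).trans hball⟩
  have hbint : ∫ x in Ω, b x = ∫ x, b x :=
    setIntegral_eq_integral_of_forall_compl_eq_zero fun x hx =>
      Function.notMem_support.1 fun h => hx (hbs h)
  have hbpos : 0 < ∫ x, b x := b.integral_pos
  have hbφ : ∀ x : Euc N, φ.rIn ≤ ‖x‖ → b x = 0 := fun x hx => b.zero_of_le_dist (by
    rw [dist_zero_right]
    exact (by norm_num : (2 : ℝ) ≤ 3).trans hx)
  have hpow : Tendsto (fun k : ℕ => (2 : ℝ) ^ k) atTop atTop :=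
    tendsto_pow_atTop_atTop_of_one_lt one_lt_two
  have h2 : ∀ k : ℕ, (0 : ℝ) < 2 ^ k := fun k => by positivity
  have hkinf : Tendsto (fun k : ℕ => ((k + 1 : ℕ) : ℝ)) atTop atTop :=
    tendsto_natCast_atTop_atTop.comp (tendsto_add_atTop_nat 1)
  have key : ∀ {ψ : Euc N → ℝ}, IsCinfc Ω ψ → ∀ (C c : ℝ) (A B : ℕ → ℝ), 0 < c →
      Tendsto A atTop (𝓝 0) → Tendsto B atTop atTop →
      (∀ k, ∃ u : Euc N → Fin n → ℝ, ContDiff ℝ (⊤ : ℕ∞) u ∧ sobNorm Ω s p u ≤ C * A k ∧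
        c * B k ≤ ∫ x in Ω,
          jacMinor m (q + 1) (Fin.castLE hn') (fun _ => Fin.castLE hN') u x * ψ x) →
      ∃ (u : ℕ → Euc N → Fin n → ℝ) (β : Fin (q + 1) → Fin n)
        (α : Fin m → Fin (q + 1) → Fin N) (ψ : Euc N → ℝ),
        (∀ k, ContDiffOn ℝ m (u k) (closure Ω)) ∧
        StrictMono β ∧ (∀ j, StrictMono (α j)) ∧ IsCinfc Ω ψ ∧
        Tendsto (fun k => sobNorm Ω s p (u k)) atTop (𝓝 0) ∧
        Tendsto (fun k => ∫ x in Ω, jacMinor m (q + 1) β α (u k) x * ψ x) atTop atTop := by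
    intro ψ hψ C c A B hc hA hB h
    choose u hu hus huJ using h
    refine ⟨u, Fin.castLE hn', fun _ => Fin.castLE hN', ψ,
      fun k => ((hu k).of_le (by exact_mod_cast le_top)).contDiffOn,
      Fin.strictMono_castLE hn', fun _ => Fin.strictMono_castLE hN', hψ, ?_, ?_⟩
    · exact squeeze_zero (fun k => sobNorm_nonneg _ _ _ _) hus (by simpa using hA.const_mul C)
    · exact tendsto_atTop_mono huJ (hB.const_mul_atTop hc)
  rcases hnotembed with hlt | ⟨hrp, hs, hsint⟩
  · rcases lt_max_iff.1 hlt with hneg | hlt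
    · obtain ⟨C, hC⟩ := exists_oscillating hn' hN' m hs0 hp1 hΩm hΩ.2.1 φ b.continuous
        b.hasCompactSupport hbφ
      have hm' : (m : ℝ) / (q + 1) * (q + 1) = m := div_mul_cancel₀ _ hr0.ne'
      set δ : ℝ := (m - m / (q + 1) - s) / 2 with hδ
      have hδ0 : 0 < δ := by linarith
      refine key hbcinfc C ((1 / 2) ^ q * ∫ x in Ω, b x)
        (fun k => ((2 : ℝ) ^ k) ^ (-δ)) (fun k => ((2 : ℝ) ^ k) ^ (δ * (q + 1)))
        (by rw [hbint]; positivity) ((tendsto_rpow_neg_atTop hδ0).comp hpow)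
        ((tendsto_rpow_atTop (by positivity)).comp hpow) fun k => ?_
      obtain ⟨u, hu, hus, huJ⟩ := hC 1 (fun _ => k) (((2 : ℝ) ^ k) ^ (-δ)) le_rfl
        (Function.injective_of_subsingleton _) (fun _ => rfl) (by positivity)
      refine ⟨u, hu, by simpa using hus, le_trans (le_of_eq ?_) huJ⟩
      rw [Fin.sum_univ_one, ← rpow_natCast (((2 : ℝ) ^ k) ^ (-δ)), ← rpow_mul (h2 k).le,
        ← rpow_add (h2 k)]
      congr 2
      push_cast
      have : (m - m / (q + 1) - s) * (q + 1) = m * q - s * (q + 1) := by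
        linear_combination -hm'
      rw [← this]
      simp only [hδ]
      ring
    · obtain ⟨C, hC⟩ := exists_concentrating hn' hN' m hs0 hp1 hΩm hΩ.2.1 (φ := φ) (b := b)
        (by norm_num [φ, b]) hball
      obtain ⟨τ, hτ₁, hτ₂⟩ := exists_between
        (show s - m + (m : ℝ) / (q + 1) + N / (q + 1) < N / p by linarith)
      have hτ₃ : 0 < τ * (q + 1) + (m * q - s * (q + 1) - N) := by
        have h3 := mul_lt_mul_of_pos_right hτ₁ hr0
        have h4 : (s - m + (m : ℝ) / (q + 1) + N / (q + 1)) * (q + 1) =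
            s * (q + 1) - m * q + N := by
          field_simp
          ring
        linarith
      refine key (ψ := cutMonomial φ m (Fin.castLE hN' (Fin.last q)))
        ⟨contDiff_cutMonomial _ _ _, hasCompactSupport_cutMonomial _ _ _,
          (tsupport_cutMonomial_subset _ _ _).trans hball⟩ C (∫ x, b x)
        (fun k => ((2 : ℝ) ^ k) ^ (-(N / p - τ)))
        (fun k => ((2 : ℝ) ^ k) ^ (τ * (q + 1) + (m * q - s * (q + 1) - N))) hbpos
        ((tendsto_rpow_neg_atTop (sub_pos.2 hτ₂)).comp hpow)
        ((tendsto_rpow_atTop hτ₃).comp hpow) fun k => ?_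
      obtain ⟨u, hu, hus, huJ⟩ := hC k (((2 : ℝ) ^ k) ^ τ) (by positivity)
      refine ⟨u, hu, hus.trans_eq ?_, ?_⟩
      · rw [← rpow_add (h2 k)]
        congr 2
        ring
      · rw [huJ, ← rpow_natCast (((2 : ℝ) ^ k) ^ τ), ← rpow_mul (h2 k).le, ← rpow_add (h2 k)]
        push_cast
        exact le_rfl
  · obtain ⟨C, hC⟩ := exists_oscillating hn' hN' m hs0 hp1 hΩm hΩ.2.1 φ b.continuous
      b.hasCompactSupport hbφ
    obtain ⟨θ, hθ₁, hθ₂⟩ := exists_between (one_div_lt_one_div_of_lt hr0 hrp)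
    have hθ₃ : 0 < 1 - θ * (q + 1) := by
      rw [lt_div_iff₀ hr0] at hθ₂
      linarith
    have hexp : (m : ℝ) * q - s * (q + 1) = 0 := by
      rw [hs]
      field_simp
      ring
    refine key hbcinfc C ((1 / 2) ^ q * ∫ x in Ω, b x)
      (fun k => ((k + 1 : ℕ) : ℝ) ^ (-(θ - 1 / p)))
      (fun k => ((k + 1 : ℕ) : ℝ) ^ (1 - θ * (q + 1)))
      (by rw [hbint]; positivity) ((tendsto_rpow_neg_atTop (sub_pos.2 hθ₁)).comp hkinf)
      ((tendsto_rpow_atTop hθ₃).comp hkinf) fun k => ?_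
    have hk : (0 : ℝ) < ((k + 1 : ℕ) : ℝ) := by positivity
    obtain ⟨u, hu, hus, huJ⟩ := hC (k + 1) Fin.val (((k + 1 : ℕ) : ℝ) ^ (-θ)) (by omega)
      Fin.val_injective (fun h => absurd h hsint) (by positivity)
    refine ⟨u, hu, hus.trans_eq ?_, le_trans (le_of_eq ?_) huJ⟩
    · rw [← rpow_add hk]
      congr 2
      ring
    · simp only [hexp, rpow_zero, Finset.sum_const, Finset.card_univ, Fintype.card_fin,
        nsmul_eq_mul, mul_one]
      rw [← rpow_natCast (((k + 1 : ℕ) : ℝ) ^ (-θ)), ← rpow_mul hk.le, ← rpow_add_one hk.ne']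
      congr 2
      push_cast
      ring
end
end
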